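/- arXiv:math/0612297 — 3 statements merged into one kernel-verified Lean document; each statement's English description precedes it below -/
import Mathlib

section
/- Let n ≥ 10 be an integer, let λ > 0, and set V_λ(r) = n(n+2)·∫₀¹ (t·U(r) + (1−t)·U^λ(r))^{4/(n-2)} dt. Then there exists a unique f_{2,λ} ∈ C^∞((λ,∞)) satisfying f_{2,λ}''(r) + ((n-1)/r)·f_{2,λ}'(r) + (V_λ(r) − 2n/r²)·f_{2,λ}(r) = −r²·U^λ(r)·(1 − (λ/r)^8) for r ∈ (λ,∞), with f_{2,λ}(λ) = 0 and lim_{r→∞} f_{2,λ}(r) = 0. Moreover, for any ε > 0 there exists δ(ε) > 0 with δ(ε) → 0 as ε → 0, and a constant C depending only on n, such that whenever |λ − 1| ≤ δ(ε) one has, for all λ < r < ∞: ((1−ε)/(6(n−4)))·U^λ(r)·( r⁴·(1 − (λ/r)^8) + ((3n−4)/(n−2))·r²·(1 − (λ/r)^4) ) ≤ f_{2,λ}(r) ≤ C·r^{6−n}. -/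
open Set Filter

/-- The standard bubble `U(r) = (1 + r²)^{-(n-2)/2}`. -/
noncomputable def U (n : ℕ) (r : ℝ) : ℝ := (1 + r ^ 2) ^ (-(((n : ℝ) - 2) / 2))

/-- The Kelvin transform `U^λ(r) = (λ/r)^{n−2} U(λ²/r)` of the standard bubble. -/
noncomputable def Ulam (n : ℕ) (lam r : ℝ) : ℝ :=
  (lam / r) ^ (((n : ℝ) - 2)) * U n (lam ^ 2 / r)

/-- `V_λ(r) = n(n+2) ∫₀¹ (t U(r) + (1−t) U^λ(r))^{4/(n-2)} dt`. -/
noncomputable def Vlam (n : ℕ) (lam r : ℝ) : ℝ :=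
  (n : ℝ) * ((n : ℝ) + 2) *
    ∫ t in (0 : ℝ)..1, (t * U n r + (1 - t) * Ulam n lam r) ^ ((4 : ℝ) / ((n : ℝ) - 2))

/-- `f` is a smooth solution of
`f'' + ((n-1)/r) f' + (V_λ − 2n/r²) f = −r² U^λ (1 − (λ/r)^8)` on `(λ,∞)`,
with `f(λ) = 0` (and `f` continuous up to `r = λ`) and `f(r) → 0` as `r → ∞`. -/
def IsSolF2lam (n : ℕ) (lam : ℝ) (f : ℝ → ℝ) : Prop :=
  ContinuousOn f (Ici lam) ∧ ContDiffOn ℝ (⊤ : ℕ∞) f (Ioi lam) ∧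
  (∀ r ∈ Ioi lam,
    deriv (deriv f) r + ((n : ℝ) - 1) / r * deriv f r +
      (Vlam n lam r - 2 * (n : ℝ) / r ^ 2) * f r
      = -(r ^ 2 * Ulam n lam r * (1 - (lam / r) ^ 8))) ∧
  f lam = 0 ∧ Tendsto f atTop (nhds 0)

/-- The vector field of the first order system equivalent to `f'' = s - p f' - q f`. -/
def linearField (p q s : ℝ → ℝ) (t : ℝ) (x : ℝ × ℝ) : ℝ × ℝ :=
  (x.2, s t - p t * x.2 - q t * x.1)

theorem dist_linearField_le {p q s : ℝ → ℝ} {t P Q : ℝ} (hp : |p t| ≤ P) (hq : |q t| ≤ Q)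
    (x y : ℝ × ℝ) :
    dist (linearField p q s t x) (linearField p q s t y) ≤ (1 + P + Q) * dist x y := by
  have hP : 0 ≤ P := (abs_nonneg _).trans hp
  have hQ : 0 ≤ Q := (abs_nonneg _).trans hq
  have h1 : |x.1 - y.1| ≤ dist x y := by rw [Prod.dist_eq]; exact le_max_left _ _
  have h2 : |x.2 - y.2| ≤ dist x y := by rw [Prod.dist_eq]; exact le_max_right _ _
  have hd : 0 ≤ dist x y := dist_nonneg
  rw [Prod.dist_eq]
  refine max_le ?_ ?_
  · simp only [linearField, Real.dist_eq]
    nlinarith [mul_nonneg hP hd, mul_nonneg hQ hd]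
  · simp only [linearField, Real.dist_eq]
    have e : s t - p t * x.2 - q t * x.1 - (s t - p t * y.2 - q t * y.1)
        = -(p t * (x.2 - y.2)) - q t * (x.1 - y.1) := by ring
    rw [e]
    calc |-(p t * (x.2 - y.2)) - q t * (x.1 - y.1)|
        ≤ |-(p t * (x.2 - y.2))| + |q t * (x.1 - y.1)| := abs_sub _ _
      _ = |p t| * |x.2 - y.2| + |q t| * |x.1 - y.1| := by rw [abs_neg, abs_mul, abs_mul]
      _ ≤ P * dist x y + Q * dist x y := by gcongr
      _ ≤ _ := by nlinarith

theorem norm_linearField_le {p q s : ℝ → ℝ} {t P Q S : ℝ} (hp : |p t| ≤ P) (hq : |q t| ≤ Q)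
    (hs : |s t| ≤ S) (x : ℝ × ℝ) : ‖linearField p q s t x‖ ≤ (1 + P + Q) * ‖x‖ + S := by
  have h := dist_linearField_le (s := s) hp hq x 0
  have h0 : ‖linearField p q s t 0‖ ≤ S := by
    simp [linearField, Prod.norm_def, hs]
  rw [dist_eq_norm, dist_zero_right] at h
  linarith [norm_le_norm_add_norm_sub' (linearField p q s t x) (linearField p q s t 0)]

/-- Coordinatewise truncation of a vector of `ℝ × ℝ` to the box `[-ρ, ρ]²`. -/
def clampBox (ρ : ℝ) (x : ℝ × ℝ) : ℝ × ℝ := (max (-ρ) (min x.1 ρ), max (-ρ) (min x.2 ρ))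

theorem lipschitzWith_clampBox (ρ : ℝ) : LipschitzWith 1 (clampBox ρ) := by
  have h := ((LipschitzWith.prod_fst (α := ℝ) (β := ℝ)).min_const ρ).const_max (-ρ)
  have h' := ((LipschitzWith.prod_snd (α := ℝ) (β := ℝ)).min_const ρ).const_max (-ρ)
  have h2 := h.prodMk h'
  rw [max_self] at h2
  exact h2

theorem clampBox_of_norm_le {ρ : ℝ} {x : ℝ × ℝ} (hx : ‖x‖ ≤ ρ) : clampBox ρ x = x := by
  rw [Prod.norm_def, max_le_iff, Real.norm_eq_abs, Real.norm_eq_abs, abs_le, abs_le] at hx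
  obtain ⟨⟨h1, h2⟩, h3, h4⟩ := hx
  simp [clampBox, h1, h2, h3, h4]

theorem norm_clampBox_le {ρ : ℝ} (hρ : 0 ≤ ρ) (x : ℝ × ℝ) : ‖clampBox ρ x‖ ≤ ρ := by
  rw [Prod.norm_def, max_le_iff, Real.norm_eq_abs, Real.norm_eq_abs, abs_le, abs_le]
  simp [clampBox, hρ]

theorem norm_clampBox_le_norm {ρ : ℝ} (hρ : 0 ≤ ρ) (x : ℝ × ℝ) : ‖clampBox ρ x‖ ≤ ‖x‖ := by
  have h0 : clampBox ρ 0 = 0 := clampBox_of_norm_le (by simpa using hρ)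
  simpa [h0] using (lipschitzWith_clampBox ρ).dist_le_mul x 0

/-- Global solvability of linear second order equations on a compact interval. -/
theorem exists_linearField_solution_Icc {a b : ℝ} (hab : a ≤ b) {p q s : ℝ → ℝ}
    (hp : ContinuousOn p (Icc a b)) (hq : ContinuousOn q (Icc a b))
    (hs : ContinuousOn s (Icc a b)) (x : ℝ × ℝ) :
    ∃ y : ℝ → ℝ × ℝ, y a = x ∧
      ∀ t ∈ Icc a b, HasDerivWithinAt y (linearField p q s t (y t)) (Icc a b) t := by
  obtain ⟨P, hP⟩ := isCompact_Icc.exists_bound_of_continuousOn hp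
  obtain ⟨Q, hQ⟩ := isCompact_Icc.exists_bound_of_continuousOn hq
  obtain ⟨S, hS⟩ := isCompact_Icc.exists_bound_of_continuousOn hs
  simp only [Real.norm_eq_abs] at hP hQ hS
  have ha : a ∈ Icc a b := left_mem_Icc.2 hab
  have hP0 : 0 ≤ P := (abs_nonneg _).trans (hP a ha)
  have hQ0 : 0 ≤ Q := (abs_nonneg _).trans (hQ a ha)
  have hS0 : 0 ≤ S := (abs_nonneg _).trans (hS a ha)
  set K : ℝ := 1 + P + Q with hK
  have hK0 : 0 ≤ K := by positivity
  set ρ : ℝ := gronwallBound ‖x‖ K S (b - a) with hρdef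
  have hmono := gronwallBound_mono (δ := ‖x‖) (norm_nonneg _) hS0 hK0
  have hρ : 0 ≤ ρ := by
    have h := hmono (sub_nonneg.2 hab)
    rw [gronwallBound_x0] at h
    exact (norm_nonneg _).trans h
  have hpl : IsPicardLindelof (fun t z => linearField p q s t (clampBox ρ z))
      (⟨a, ha⟩ : Icc a b) x (((K * ρ + S) * (b - a)).toNNReal) 0 (K * ρ + S).toNNReal
      K.toNNReal := by
    refine ⟨fun t ht => ?_, fun z _ => ?_, fun t ht z _ => ?_, ?_⟩
    · refine (LipschitzWith.of_dist_le_mul fun z w => ?_).lipschitzOnWith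
      rw [Real.coe_toNNReal _ hK0]
      refine (dist_linearField_le (hP t ht) (hQ t ht) _ _).trans ?_
      gcongr
      simpa using (lipschitzWith_clampBox ρ).dist_le_mul z w
    · simp only [linearField]
      fun_prop
    · rw [Real.coe_toNNReal _ (by positivity)]
      refine (norm_linearField_le (hP t ht) (hQ t ht) (hS t ht) _).trans ?_
      have := norm_clampBox_le hρ z
      gcongr
    · have hba : 0 ≤ b - a := sub_nonneg.2 hab
      rw [Real.coe_toNNReal _ (by positivity), Real.coe_toNNReal _ (by positivity)]
      simp [hba]
  obtain ⟨y, hya, hy⟩ := hpl.exists_eq_forall_mem_Icc_hasDerivWithinAt₀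
  have hcont : ContinuousOn y (Icc a b) := fun t ht => (hy t ht).continuousWithinAt
  have hbound : ∀ t ∈ Icc a b, ‖y t‖ ≤ ρ := by
    intro t ht
    have h := norm_le_gronwallBound_of_norm_deriv_right_le (δ := ‖x‖) (K := K) (ε := S) hcont
      (fun t ht => (hy t (Ico_subset_Icc_self ht)).mono_of_mem_nhdsWithin
        (Icc_mem_nhdsGE_of_mem ht)) (by rw [← hya]) (fun t ht => ?_) t ht
    · exact h.trans (hmono (by linarith [ht.2]))
    · have ht' := Ico_subset_Icc_self ht
      refine (norm_linearField_le (hP t ht') (hQ t ht') (hS t ht') _).trans ?_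
      have := norm_clampBox_le_norm hρ (y t)
      gcongr
  refine ⟨y, hya, fun t ht => ?_⟩
  have h := hy t ht
  simp only [clampBox_of_norm_le (hbound t ht)] at h
  exact h

theorem linearField_solution_unique {a b : ℝ} (hab : a ≤ b) {p q s : ℝ → ℝ}
    (hp : ContinuousOn p (Icc a b)) (hq : ContinuousOn q (Icc a b)) {y z : ℝ → ℝ × ℝ}
    (hy : ∀ t ∈ Icc a b, HasDerivWithinAt y (linearField p q s t (y t)) (Icc a b) t)
    (hz : ∀ t ∈ Icc a b, HasDerivWithinAt z (linearField p q s t (z t)) (Icc a b) t)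
    (h : y a = z a) : EqOn y z (Icc a b) := by
  obtain ⟨P, hP⟩ := isCompact_Icc.exists_bound_of_continuousOn hp
  obtain ⟨Q, hQ⟩ := isCompact_Icc.exists_bound_of_continuousOn hq
  have ha : a ∈ Icc a b := left_mem_Icc.2 hab
  have hP0 : 0 ≤ P := (norm_nonneg _).trans (hP a ha)
  have hQ0 : 0 ≤ Q := (norm_nonneg _).trans (hQ a ha)
  refine ODE_solution_unique_of_mem_Icc_right (v := linearField p q s) (s := fun _ => univ)
    (K := (1 + P + Q).toNNReal) (fun t ht => ?_)
    (fun t ht => (hy t ht).continuousWithinAt)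
    (fun t ht => (hy t (Ico_subset_Icc_self ht)).mono_of_mem_nhdsWithin
        (Icc_mem_nhdsGE_of_mem ht)) (fun _ _ => mem_univ _)
    (fun t ht => (hz t ht).continuousWithinAt)
    (fun t ht => (hz t (Ico_subset_Icc_self ht)).mono_of_mem_nhdsWithin
        (Icc_mem_nhdsGE_of_mem ht)) (fun _ _ => mem_univ _) h
  refine (LipschitzWith.of_dist_le_mul fun z w => ?_).lipschitzOnWith
  rw [Real.coe_toNNReal _ (by positivity)]
  have ht' := Ico_subset_Icc_self ht
  exact dist_linearField_le (hP t ht') (hQ t ht') _ _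

/-- Global solvability of linear second order equations on a half-line. -/
theorem exists_linear_ode_solution {a : ℝ} {p q s : ℝ → ℝ} (hp : ContinuousOn p (Ici a))
    (hq : ContinuousOn q (Ici a)) (hs : ContinuousOn s (Ici a)) (x0 x1 : ℝ) :
    ∃ f f1 : ℝ → ℝ, f a = x0 ∧ f1 a = x1 ∧ ∀ t ∈ Ici a, HasDerivWithinAt f (f1 t) (Ici a) t ∧
      HasDerivWithinAt f1 (s t - p t * f1 t - q t * f t) (Ici a) t := by
  have hsub : ∀ b, Icc a b ⊆ Ici a := fun b => Icc_subset_Ici_self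
  have hex : ∀ k : ℕ, ∃ y : ℝ → ℝ × ℝ, y a = (x0, x1) ∧ ∀ t ∈ Icc a (a + k),
      HasDerivWithinAt y (linearField p q s t (y t)) (Icc a (a + k)) t := fun k =>
    exists_linearField_solution_Icc (by simp) (hp.mono (hsub _)) (hq.mono (hsub _))
      (hs.mono (hsub _)) _
  choose Y hYa hY using hex
  have hagree : ∀ j k : ℕ, j ≤ k → EqOn (Y j) (Y k) (Icc a (a + j)) := by
    intro j k hjk
    have hss : Icc a (a + (j : ℝ)) ⊆ Icc a (a + k) :=
      Icc_subset_Icc_right (by gcongr)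
    exact linearField_solution_unique (by simp) (hp.mono (hsub _)) (hq.mono (hsub _)) (hY j)
      (fun t ht => (hY k t (hss ht)).mono hss) (by rw [hYa, hYa])
  let y : ℝ → ℝ × ℝ := fun t => Y ⌈t - a⌉₊ t
  have hyY : ∀ k : ℕ, EqOn y (Y k) (Icc a (a + k)) := by
    intro k t ht
    refine hagree _ k ?_ ⟨ht.1, ?_⟩
    · exact Nat.ceil_le.2 (by linarith [ht.2])
    · linarith [Nat.le_ceil (t - a)]
  have hy : ∀ t ∈ Ici a, HasDerivWithinAt y (linearField p q s t (y t)) (Ici a) t := by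
    intro t ht
    obtain ⟨k, hk⟩ := exists_nat_gt (t - a)
    have htk : t < a + k := by linarith
    have htm : t ∈ Icc a (a + k) := ⟨ht, htk.le⟩
    have h1 : HasDerivWithinAt y (linearField p q s t (y t)) (Icc a (a + k)) t := by
      rw [hyY k htm]
      exact (hY k t htm).congr (hyY k) (hyY k htm)
    refine h1.mono_of_mem_nhdsWithin ?_
    rw [← Ici_inter_Iic]
    exact inter_mem_nhdsWithin _ (Iic_mem_nhds htk)
  have hya : y a = (x0, x1) := by rw [hyY 0 (by simp), hYa]
  refine ⟨fun t => (y t).1, fun t => (y t).2, by simp [hya], by simp [hya], fun t ht => ?_⟩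
  have h := hy t ht
  exact ⟨h.fst, h.snd⟩

/-- `f1` and `f2` are the first and second derivatives of `f` at the points of `s`. -/
def HasSecondDerivOn (f f1 f2 : ℝ → ℝ) (s : Set ℝ) : Prop :=
  ∀ r ∈ s, HasDerivAt f (f1 r) r ∧ HasDerivAt f1 (f2 r) r

theorem HasSecondDerivOn.mono {f f1 f2 : ℝ → ℝ} {s t : Set ℝ} (h : HasSecondDerivOn f f1 f2 t)
    (hst : s ⊆ t) : HasSecondDerivOn f f1 f2 s := fun r hr => h r (hst hr)

theorem HasSecondDerivOn.add {f f1 f2 g g1 g2 : ℝ → ℝ} {s : Set ℝ}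
    (hf : HasSecondDerivOn f f1 f2 s) (hg : HasSecondDerivOn g g1 g2 s) :
    HasSecondDerivOn (fun r => f r + g r) (fun r => f1 r + g1 r) (fun r => f2 r + g2 r) s :=
  fun r hr => ⟨(hf r hr).1.add (hg r hr).1, (hf r hr).2.add (hg r hr).2⟩

theorem HasSecondDerivOn.sub {f f1 f2 g g1 g2 : ℝ → ℝ} {s : Set ℝ}
    (hf : HasSecondDerivOn f f1 f2 s) (hg : HasSecondDerivOn g g1 g2 s) :
    HasSecondDerivOn (fun r => f r - g r) (fun r => f1 r - g1 r) (fun r => f2 r - g2 r) s :=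
  fun r hr => ⟨(hf r hr).1.sub (hg r hr).1, (hf r hr).2.sub (hg r hr).2⟩

theorem HasSecondDerivOn.const_mul {f f1 f2 : ℝ → ℝ} {s : Set ℝ} (c : ℝ)
    (hf : HasSecondDerivOn f f1 f2 s) :
    HasSecondDerivOn (fun r => c * f r) (fun r => c * f1 r) (fun r => c * f2 r) s :=
  fun r hr => ⟨(hf r hr).1.const_mul c, (hf r hr).2.const_mul c⟩

theorem HasSecondDerivOn.mul {f f1 f2 g g1 g2 : ℝ → ℝ} {s : Set ℝ}
    (hf : HasSecondDerivOn f f1 f2 s) (hg : HasSecondDerivOn g g1 g2 s) :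
    HasSecondDerivOn (fun r => f r * g r) (fun r => f1 r * g r + f r * g1 r)
      (fun r => f2 r * g r + 2 * (f1 r * g1 r) + f r * g2 r) s := by
  refine fun r hr => ⟨(hf r hr).1.mul (hg r hr).1, ?_⟩
  refine (((hf r hr).2.mul (hg r hr).1).add ((hf r hr).1.mul (hg r hr).2)).congr_deriv ?_
  ring

theorem HasSecondDerivOn.continuousOn {f f1 f2 : ℝ → ℝ} {s : Set ℝ}
    (hf : HasSecondDerivOn f f1 f2 s) : ContinuousOn f s :=
  fun r hr => (hf r hr).1.continuousAt.continuousWithinAt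

/-- At an interior local minimum the second derivative is nonnegative. -/
theorem HasSecondDerivOn.nonneg_of_isLocalMin {f f1 f2 : ℝ → ℝ} {s : Set ℝ} (hs : IsOpen s)
    (hf : HasSecondDerivOn f f1 f2 s) {r : ℝ} (hr : r ∈ s) (hmin : IsLocalMin f r) :
    0 ≤ f2 r := by
  by_contra! hneg
  have hev : deriv f =ᶠ[nhds r] f1 := by
    filter_upwards [hs.mem_nhds hr] with x hx using (hf x hx).1.deriv
  have hdd : deriv (deriv f) r = f2 r := by rw [hev.deriv_eq, (hf r hr).2.deriv]
  have hmax : IsLocalMax f r := isLocalMax_of_deriv_deriv_neg (by rw [hdd]; exact hneg)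
    hmin.deriv_eq_zero (hf r hr).1.continuousAt
  have hconst : f =ᶠ[nhds r] fun _ => f r := by
    filter_upwards [hmin, hmax] with x h1 h2 using le_antisymm h2 h1
  have h0 : deriv (deriv f) r = 0 := by
    rw [hconst.deriv.deriv_eq]
    simp
  linarith [hdd ▸ h0]

/-- Maximum principle on a compact interval in the presence of a positive strict
supersolution. -/
theorem nonneg_of_supersolution_Icc {a b : ℝ} {p q W W1 W2 h h1 h2 : ℝ → ℝ}
    (hWc : ContinuousOn W (Icc a b)) (hWpos : ∀ r ∈ Icc a b, 0 < W r)
    (hW : HasSecondDerivOn W W1 W2 (Ioo a b))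
    (hLW : ∀ r ∈ Ioo a b, W2 r + p r * W1 r + q r * W r < 0)
    (hc : ContinuousOn h (Icc a b)) (hh : HasSecondDerivOn h h1 h2 (Ioo a b))
    (hLh : ∀ r ∈ Ioo a b, h2 r + p r * h1 r + q r * h r ≤ 0)
    (ha : 0 ≤ h a) (hb : 0 ≤ h b) : ∀ r ∈ Icc a b, 0 ≤ h r := by
  intro r hr
  obtain ⟨x, hx, hmin⟩ := isCompact_Icc.exists_isMinOn ⟨r, hr⟩
    (hc.div hWc fun y hy => (hWpos y hy).ne')
  by_contra! hneg
  set m : ℝ := -(h x / W x) with hm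
  have hmpos : 0 < m := by
    have h3 : h x / W x ≤ h r / W r := hmin hr
    have h4 : h r / W r < 0 := div_neg_of_neg_of_pos hneg (hWpos r hr)
    linarith
  have hhx : h x + m * W x = 0 := by
    have := (hWpos x hx).ne'
    rw [hm]; field_simp; ring
  have hhneg : h x < 0 := by nlinarith [hWpos x hx]
  have hxo : x ∈ Ioo a b := by
    refine ⟨lt_of_le_of_ne hx.1 ?_, lt_of_le_of_ne hx.2 ?_⟩
    · rintro rfl; linarith
    · rintro rfl; linarith
  have hk := hh.add (hW.const_mul m)
  have hloc : IsLocalMin (fun r => h r + m * W r) x := by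
    filter_upwards [Icc_mem_nhds hxo.1 hxo.2] with y hy
    have h3 : h x / W x ≤ h y / W y := hmin hy
    rw [hhx]
    have h4 : -m * W y ≤ h y := by
      rw [← le_div_iff₀ (hWpos y hy)]; linarith
    linarith
  have h5 := hk.nonneg_of_isLocalMin isOpen_Ioo hxo hloc
  have h6 : h1 x + m * W1 x = 0 := hloc.hasDerivAt_eq_zero (hk x hxo).1
  have h7 := mul_neg_of_pos_of_neg hmpos (hLW x hxo)
  have h8 := hLh x hxo
  have h9 : (h2 x + p x * h1 x + q x * h x) + m * (W2 x + p x * W1 x + q x * W x)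
      = h2 x + m * W2 x := by linear_combination p x * h6 + q x * hhx
  linarith

/-- Maximum principle on a half-line for functions vanishing at infinity. -/
theorem nonneg_of_supersolution_Ici {a c : ℝ} {p q W W1 W2 h h1 h2 : ℝ → ℝ} (hcpos : 0 < c)
    (hWc : ContinuousOn W (Ici a)) (hWpos : ∀ r ∈ Ici a, c ≤ W r)
    (hW : HasSecondDerivOn W W1 W2 (Ioi a))
    (hLW : ∀ r ∈ Ioi a, W2 r + p r * W1 r + q r * W r < 0)
    (hc : ContinuousOn h (Ici a)) (hh : HasSecondDerivOn h h1 h2 (Ioi a))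
    (hLh : ∀ r ∈ Ioi a, h2 r + p r * h1 r + q r * h r ≤ 0)
    (ha : 0 ≤ h a) (hlim : Tendsto h atTop (nhds 0)) : ∀ r ∈ Ici a, 0 ≤ h r := by
  intro r hr
  have hWr : 0 < W r := hcpos.trans_le (hWpos r hr)
  refine le_of_forall_pos_le_add fun η hη => ?_
  set κ : ℝ := η / W r with hκ
  have hκpos : 0 < κ := by positivity
  obtain ⟨b, hb1, hb2⟩ : ∃ b, r ≤ b ∧ -(κ * c) < h b := by
    have h1 := hlim.eventually_const_lt (show -(κ * c) < 0 by nlinarith)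
    obtain ⟨b, hb⟩ := (h1.and (eventually_ge_atTop r)).exists
    exact ⟨b, hb.2, hb.1⟩
  have hab : a ≤ b := le_trans hr hb1
  have hs : Icc a b ⊆ Ici a := Icc_subset_Ici_self
  have ho : Ioo a b ⊆ Ioi a := Ioo_subset_Ioi_self
  have key := nonneg_of_supersolution_Icc (p := p) (q := q) (hWc.mono hs)
    (fun y hy => hcpos.trans_le (hWpos y (hs hy))) (hW.mono ho) (fun y hy => hLW y (ho hy))
    ((hc.mono hs).add ((hWc.mono hs).const_mul κ)) ((hh.add (hW.const_mul κ)).mono ho)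
    (fun y hy => by
      have h3 := mul_neg_of_pos_of_neg hκpos (hLW y (ho hy))
      have h4 := hLh y (ho hy)
      show h2 y + κ * W2 y + p y * (h1 y + κ * W1 y) + q y * (h y + κ * W y) ≤ 0
      linarith)
    (by
      have := mul_pos hκpos (hcpos.trans_le (hWpos a (mem_Ici.2 le_rfl)))
      show 0 ≤ h a + κ * W a
      linarith)
    (by
      have := mul_le_mul_of_nonneg_left (hWpos b hab) hκpos.le
      show 0 ≤ h b + κ * W b
      linarith) r ⟨hr, hb1⟩
  have h5 : κ * W r = η := by rw [hκ]; field_simp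
  have h6 : 0 ≤ h r + κ * W r := key
  linarith

theorem HasDerivWithinAt.exists_pos_near_left_end {f : ℝ → ℝ} {a d : ℝ} (hd : 0 < d)
    (hf : HasDerivWithinAt f d (Ici a) a) (h0 : f a = 0) {R : ℝ} (hR : a < R) :
    ∃ x ∈ Ioo a R, 0 < f x := by
  have h1 := (hasDerivWithinAt_iff_tendsto_slope' self_notMem_Ioi).1 hf.Ioi_of_Ici
  have h2 := (h1.eventually_const_lt hd).and (Ioo_mem_nhdsGT hR)
  obtain ⟨x, hx1, hx2⟩ := h2.exists
  refine ⟨x, hx2, ?_⟩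
  rw [slope_def_field, h0, sub_zero] at hx1
  have := sub_pos.2 hx2.1
  exact (div_pos_iff_of_pos_right this).1 hx1

/-- Solvability of the boundary value problem on a half-line by shooting, when a positive
supersolution of the homogeneous equation and a decaying supersolution are available. -/
theorem exists_bvp_solution {a : ℝ} {p q s W W1 W2 Φ Φ1 Φ2 : ℝ → ℝ}
    (hp : ContinuousOn p (Ici a)) (hq : ContinuousOn q (Ici a)) (hs : ContinuousOn s (Ici a))
    (hs0 : ∀ r ∈ Ioi a, s r ≤ 0)
    (hWc : ContinuousOn W (Ici a)) (hWpos : ∀ r ∈ Ici a, 0 < W r)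
    (hW : HasSecondDerivOn W W1 W2 (Ioi a))
    (hLW : ∀ r ∈ Ioi a, W2 r + p r * W1 r + q r * W r < 0)
    (hΦc : ContinuousOn Φ (Ici a)) (hΦpos : ∀ r ∈ Ici a, 0 ≤ Φ r)
    (hΦ : HasSecondDerivOn Φ Φ1 Φ2 (Ioi a))
    (hLΦ : ∀ r ∈ Ioi a, Φ2 r + p r * Φ1 r + q r * Φ r ≤ s r) :
    ∃ f f1 : ℝ → ℝ, ContinuousOn f (Ici a) ∧
      HasSecondDerivOn f f1 (fun r => s r - p r * f1 r - q r * f r) (Ioi a) ∧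
      f a = 0 ∧ ∀ r ∈ Ici a, 0 ≤ f r ∧ f r ≤ Φ r := by
  obtain ⟨u, u1, hua, hu1a, hu⟩ := exists_linear_ode_solution hp hq
    (continuousOn_const (c := (0 : ℝ))) 0 1
  obtain ⟨v, v1, hva, -, hv⟩ := exists_linear_ode_solution hp hq hs 0 0
  have huc : ContinuousOn u (Ici a) := fun t ht => (hu t ht).1.continuousWithinAt
  have hvc : ContinuousOn v (Ici a) := fun t ht => (hv t ht).1.continuousWithinAt
  have hmem : ∀ {t}, t ∈ Ioi a → t ∈ Ici a := fun ht => Ioi_subset_Ici_self ht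
  have hus : HasSecondDerivOn u u1 (fun t => 0 - p t * u1 t - q t * u t) (Ioi a) := fun t ht =>
    ⟨(hu t (hmem ht)).1.hasDerivAt (Ici_mem_nhds ht),
      (hu t (hmem ht)).2.hasDerivAt (Ici_mem_nhds ht)⟩
  have hvs : HasSecondDerivOn v v1 (fun t => s t - p t * v1 t - q t * v t) (Ioi a) := fun t ht =>
    ⟨(hv t (hmem ht)).1.hasDerivAt (Ici_mem_nhds ht),
      (hv t (hmem ht)).2.hasDerivAt (Ici_mem_nhds ht)⟩
  have hsub : ∀ b, Icc a b ⊆ Ici a := fun b => Icc_subset_Ici_self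
  have hsub' : ∀ b, Ioo a b ⊆ Ioi a := fun b => Ioo_subset_Ioi_self
  have hMP : ∀ {b : ℝ} {h h1 h2 : ℝ → ℝ}, ContinuousOn h (Ici a) →
      HasSecondDerivOn h h1 h2 (Ioi a) →
      (∀ r ∈ Ioi a, h2 r + p r * h1 r + q r * h r ≤ 0) → 0 ≤ h a → 0 ≤ h b →
      ∀ r ∈ Icc a b, 0 ≤ h r := fun {b _ _ _} hc hh hL ha hb =>
    nonneg_of_supersolution_Icc (hWc.mono (hsub b)) (fun r hr => hWpos r (hsub b hr))
      (hW.mono (hsub' b)) (fun r hr => hLW r (hsub' b hr)) (hc.mono (hsub b))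
      (hh.mono (hsub' b)) (fun r hr => hL r (hsub' b hr)) ha hb
  have hupos : ∀ R ∈ Ioi a, 0 < u R := by
    intro R hR
    by_contra! hneg
    have hu1 := (hu a (mem_Ici.2 le_rfl)).1
    rw [hu1a] at hu1
    obtain ⟨x, hx, hxpos⟩ := hu1.exists_pos_near_left_end one_pos hua hR
    have := hMP (b := R) (huc.const_mul (-1)) (hus.const_mul (-1))
      (fun r _ => le_of_eq (by ring)) (by rw [hua]; simp) (by linarith) x
      (Ioo_subset_Icc_self hx)
    linarith
  have hcomb : ∀ c : ℝ, HasSecondDerivOn (fun r => v r + c * u r) (fun r => v1 r + c * u1 r)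
      (fun r => s r - p r * (v1 r + c * u1 r) - q r * (v r + c * u r)) (Ioi a) := by
    intro c r hr
    obtain ⟨h1, h2⟩ := (hvs.add (hus.const_mul c)) r hr
    exact ⟨h1, h2.congr_deriv (by ring)⟩
  have hcombc : ∀ c : ℝ, ContinuousOn (fun r => v r + c * u r) (Ici a) := fun c =>
    hvc.add (huc.const_mul c)
  let c : ℝ → ℝ := fun R => -(v R / u R)
  have hbd : ∀ R ∈ Ioi a, ∀ r ∈ Icc a R, 0 ≤ v r + c R * u r ∧ v r + c R * u r ≤ Φ r := by
    intro R hR r hr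
    have hend : v R + c R * u R = 0 := by
      have := (hupos R hR).ne'
      simp only [c]; field_simp; ring
    have hRm : R ∈ Ici a := hmem hR
    refine ⟨hMP (b := R) (hcombc (c R)) (hcomb (c R)) (fun r hr => ?_) ?_ ?_ r hr, ?_⟩
    · have := hs0 r hr
      linarith
    · simp [hua, hva]
    · exact hend.ge
    · have h := hMP (b := R) (h := fun r => Φ r - (v r + c R * u r)) (hΦc.sub (hcombc (c R))) (hΦ.sub (hcomb (c R))) (fun r hr => ?_)
        ?_ ?_ r hr
      · exact sub_nonneg.1 h
      · have := hLΦ r hr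
        linarith
      · simpa [hua, hva] using hΦpos a (mem_Ici.2 le_rfl)
      · have := hΦpos R hRm
        show 0 ≤ Φ R - (v R + c R * u R)
        linarith
  have hr1 : a + 1 ∈ Ioi a := by simp
  have hcmem : ∀ k : ℕ, c (a + 1 + k) ∈
      Icc (-v (a + 1) / u (a + 1)) ((Φ (a + 1) - v (a + 1)) / u (a + 1)) := by
    intro k
    have hk : (0 : ℝ) ≤ k := Nat.cast_nonneg k
    obtain ⟨h1, h2⟩ := hbd (a + 1 + k) (by simp only [mem_Ioi]; linarith) (a + 1)
      ⟨by linarith, by linarith⟩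
    have hpos := hupos _ hr1
    exact ⟨by rw [div_le_iff₀ hpos]; linarith, by rw [le_div_iff₀ hpos]; linarith⟩
  obtain ⟨c0, -, φ, hφ, hlim⟩ := isCompact_Icc.tendsto_subseq hcmem
  refine ⟨_, _, hcombc c0, hcomb c0, by simp [hua, hva], fun r hr => ?_⟩
  have htend : Tendsto (fun k => v r + c (a + 1 + (φ k : ℕ)) * u r) atTop
      (nhds (v r + c0 * u r)) := (hlim.mul_const _).const_add _
  have hev : ∀ᶠ k : ℕ in atTop, r ∈ Icc a (a + 1 + (φ k : ℕ)) := by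
    obtain ⟨N, hN⟩ := exists_nat_gt (r - a)
    filter_upwards [eventually_ge_atTop N] with k hk
    have h1 : (N : ℝ) ≤ (φ k : ℕ) := by exact_mod_cast hk.trans (hφ.id_le k)
    exact ⟨hr, by linarith⟩
  have hpos' : ∀ k : ℕ, a + 1 + (φ k : ℕ) ∈ Ioi a := fun k => by
    have : (0 : ℝ) ≤ (φ k : ℕ) := Nat.cast_nonneg _
    simp only [mem_Ioi]; linarith
  exact ⟨ge_of_tendsto htend (hev.mono fun k hk => (hbd _ (hpos' k) r hk).1),
    le_of_tendsto htend (hev.mono fun k hk => (hbd _ (hpos' k) r hk).2)⟩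

theorem hasSecondDerivOn_sq_add_rpow {c : ℝ} (hc : 0 < c) (e : ℝ) :
    HasSecondDerivOn (fun r => (r ^ 2 + c) ^ e) (fun r => 2 * e * r * (r ^ 2 + c) ^ e / (r ^ 2 + c))
      (fun r => (2 * e / (r ^ 2 + c) + 4 * e * (e - 1) * r ^ 2 / (r ^ 2 + c) ^ 2) *
        (r ^ 2 + c) ^ e) univ := by
  have hd : ∀ e r : ℝ, HasDerivAt (fun r : ℝ => (r ^ 2 + c) ^ e)
      (2 * e * r * (r ^ 2 + c) ^ e / (r ^ 2 + c)) r := by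
    intro e r
    have hpos : 0 < r ^ 2 + c := by positivity
    have h1 : HasDerivAt (fun r : ℝ => r ^ 2 + c) (2 * r) r := by
      simpa using (hasDerivAt_pow 2 r).add_const c
    refine (h1.rpow_const (p := e) (Or.inl hpos.ne')).congr_deriv ?_
    rw [Real.rpow_sub_one hpos.ne']
    ring
  intro r _
  refine ⟨hd e r, ?_⟩
  have hpos : 0 < r ^ 2 + c := by positivity
  have h1 : HasDerivAt (fun r : ℝ => r ^ 2 + c) (2 * r) r := by
    simpa using (hasDerivAt_pow 2 r).add_const c
  refine ((((hasDerivAt_id r).const_mul (2 * e)).mul (hd e r)).div h1 hpos.ne').congr_deriv ?_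
  simp only [id, Pi.mul_apply]
  field_simp
  ring

theorem hasSecondDerivOn_rpow (q : ℝ) :
    HasSecondDerivOn (fun r => r ^ q) (fun r => q * r ^ q / r) (fun r => q * (q - 1) * r ^ q / r ^ 2)
      (Ioi 0) := by
  have hd : ∀ r ∈ Ioi (0 : ℝ), HasDerivAt (fun r : ℝ => r ^ q) (q * r ^ q / r) r := by
    intro r hr
    have hr' : r ≠ 0 := (mem_Ioi.1 hr).ne'
    refine (Real.hasDerivAt_rpow_const (Or.inl hr')).congr_deriv ?_
    rw [Real.rpow_sub_one hr', mul_div_assoc]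
  intro r hr
  have hr' : r ≠ 0 := (mem_Ioi.1 hr).ne'
  refine ⟨hd r hr, ?_⟩
  refine (((hd r hr).const_mul q).div (hasDerivAt_id r) hr').congr_deriv ?_
  simp only [id]
  field_simp

theorem hasSecondDerivOn_id (s : Set ℝ) :
    HasSecondDerivOn (fun r => r) (fun _ => 1) (fun _ => 0) s :=
  fun r _ => ⟨hasDerivAt_id r, hasDerivAt_const r 1⟩

/-- Strict supersolutions `r ^ q + M r (r² + σ²)^{-n/2}` of the equation with potential
`V - 2n/r²`, for `V` below a rescaled bubble potential. -/
theorem exists_supersolution {n : ℕ} (hn : 10 ≤ n) {q : ℝ} (hq0 : q ≤ 0)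
    (hq : q * (q + n - 2) ≤ 0) {r0 S : ℝ} (hr0 : 0 < r0) (hS : 0 < S) :
    ∃ M : ℝ, 0 < M ∧ ∀ σ : ℝ, 0 < σ → σ ≤ S → ∃ g1 g2 : ℝ → ℝ,
      HasSecondDerivOn (fun r => r ^ q + M * (r * (r ^ 2 + σ ^ 2) ^ (-((n : ℝ) / 2)))) g1 g2
        (Ioi 0) ∧
      ∀ r, r0 ≤ r → ∀ V : ℝ, V ≤ n * (n + 2) * σ ^ 2 / (r ^ 2 + σ ^ 2) ^ 2 →
        g2 r + ((n : ℝ) - 1) / r * g1 r + (V - 2 * n / r ^ 2) *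
          (r ^ q + M * (r * (r ^ 2 + σ ^ 2) ^ (-((n : ℝ) / 2)))) ≤ -(n * r ^ q / r ^ 2) := by
  have hn' : (10 : ℝ) ≤ n := by exact_mod_cast hn
  set B : ℝ := (((n : ℝ) + 3) * S ^ 2) ^ (-((n : ℝ) / 2)) with hB
  have hBpos : 0 < B := by positivity
  have hr0q : 0 < r0 ^ q := by positivity
  set M : ℝ := n * (n + 2) * r0 ^ q / (r0 * B) with hM
  have hMpos : 0 < M := by positivity
  refine ⟨M, hMpos, fun σ hσ hσS => ⟨_, _, (hasSecondDerivOn_rpow q).add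
    (((hasSecondDerivOn_id _).mul ((hasSecondDerivOn_sq_add_rpow (sq_pos_of_pos hσ)
      (-((n : ℝ) / 2))).mono (subset_univ _))).const_mul M), fun r hr V hV => ?_⟩⟩
  have hrpos : 0 < r := hr0.trans_le hr
  have hD : 0 < r ^ 2 + σ ^ 2 := by positivity
  set b : ℝ := (r ^ 2 + σ ^ 2) ^ (-((n : ℝ) / 2)) with hb
  have hbpos : 0 < b := by positivity
  set y : ℝ := r ^ q with hy
  have hypos : 0 < y := by positivity
  set V0 : ℝ := n * (n + 2) * σ ^ 2 / (r ^ 2 + σ ^ 2) ^ 2 with hV0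
  have key : q * (q - 1) * y / r ^ 2 + M * (0 * b + 2 * (1 * (2 * -((n : ℝ) / 2) * r * b /
      (r ^ 2 + σ ^ 2))) + r * ((2 * -((n : ℝ) / 2) / (r ^ 2 + σ ^ 2) + 4 * -((n : ℝ) / 2) *
      (-((n : ℝ) / 2) - 1) * r ^ 2 / (r ^ 2 + σ ^ 2) ^ 2) * b)) + ((n : ℝ) - 1) / r *
      (q * y / r + M * (1 * b + r * (2 * -((n : ℝ) / 2) * r * b / (r ^ 2 + σ ^ 2)))) +
      (V0 - 2 * n / r ^ 2) * (y + M * (r * b))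
      = y / r ^ 2 * (q * (q + n - 2)) + y / r ^ 2 * (V0 * r ^ 2 - 2 * n)
        - M * (n + 1) * (r * b) / r ^ 2 := by
    rw [hV0]
    field_simp
    ring
  have hmono : (V - 2 * n / r ^ 2) * (y + M * (r * b)) ≤
      (V0 - 2 * n / r ^ 2) * (y + M * (r * b)) := by
    gcongr
  have h1 : y / r ^ 2 * (q * (q + n - 2)) ≤ 0 :=
    mul_nonpos_of_nonneg_of_nonpos (by positivity) hq
  have h2 : y / r ^ 2 * (V0 * r ^ 2 - 2 * n) - M * (n + 1) * (r * b) / r ^ 2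
      ≤ -(n * y / r ^ 2) := by
    have h3 : y * (V0 * r ^ 2 - n) ≤ M * (n + 1) * (r * b) := by
      rcases le_or_gt ((n + 2) * σ ^ 2) (r ^ 2) with hc | hc
      · have h4 : V0 * r ^ 2 ≤ n := by
          rw [hV0, div_mul_eq_mul_div, div_le_iff₀ (by positivity)]
          have h5 : ((n + 2) * σ ^ 2) * r ^ 2 ≤ (r ^ 2 + σ ^ 2) ^ 2 := by
            have h6 := mul_le_mul_of_nonneg_right hc (sq_nonneg r)
            have h7 : r ^ 2 * r ^ 2 ≤ (r ^ 2 + σ ^ 2) ^ 2 := by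
              rw [sq (r ^ 2 + σ ^ 2)]; gcongr <;> linarith [sq_nonneg σ]
            exact h6.trans h7
          have h6 := mul_le_mul_of_nonneg_left h5 (show (0 : ℝ) ≤ n by positivity)
          linarith
        have h5 : y * (V0 * r ^ 2 - n) ≤ 0 :=
          mul_nonpos_of_nonneg_of_nonpos hypos.le (by linarith)
        have h6 : 0 ≤ M * (n + 1) * (r * b) := by positivity
        linarith
      · have h4 : V0 * r ^ 2 ≤ n * (n + 2) := by
          rw [hV0, div_mul_eq_mul_div, div_le_iff₀ (by positivity)]
          have h5 : σ ^ 2 * r ^ 2 ≤ (r ^ 2 + σ ^ 2) ^ 2 := by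
            rw [sq (r ^ 2 + σ ^ 2)]
            gcongr <;> linarith [sq_nonneg σ, sq_nonneg r]
          have h6 := mul_le_mul_of_nonneg_left h5 (show (0 : ℝ) ≤ n * (n + 2) by positivity)
          linarith
        have h5 : y ≤ r0 ^ q := Real.rpow_le_rpow_of_nonpos hr0 hr hq0
        have h6 : B ≤ b := by
          refine Real.rpow_le_rpow_of_nonpos hD ?_ (by linarith)
          have : σ ^ 2 ≤ S ^ 2 := by gcongr
          nlinarith
        have h7 : M * (r0 * B) = n * (n + 2) * r0 ^ q := by
          rw [hM]; field_simp
        have h8 : M * (r0 * B) ≤ M * (r * b) := by gcongr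
        have h9 : y * (V0 * r ^ 2 - n) ≤ y * (n * (n + 2)) := by
          gcongr; linarith
        have h10 : y * (n * (n + 2)) ≤ r0 ^ q * (n * (n + 2)) := by gcongr
        have h11 : 0 ≤ M * n * (r * b) := by positivity
        linarith
    have h4 : y / r ^ 2 * (V0 * r ^ 2 - 2 * n) - M * (n + 1) * (r * b) / r ^ 2 + n * y / r ^ 2
        = (y * (V0 * r ^ 2 - n) - M * (n + 1) * (r * b)) / r ^ 2 := by
      field_simp
      ring
    have h5 := div_nonpos_of_nonpos_of_nonneg (sub_nonpos.2 h3) (sq_nonneg r)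
    linarith
  refine le_trans (add_le_add_right hmono _) ?_
  linarith [key]

theorem Ulam_eq {n : ℕ} {lam r : ℝ} (hlam : 0 < lam) (hr : 0 < r) :
    Ulam n lam r = (lam ^ 2 / (r ^ 2 + lam ^ 4)) ^ (((n : ℝ) - 2) / 2) := by
  have h1 : (lam / r) ^ ((n : ℝ) - 2) = ((lam / r) ^ 2) ^ (((n : ℝ) - 2) / 2) := by
    rw [← Real.rpow_natCast (lam / r) 2, ← Real.rpow_mul (by positivity)]
    congr 1
    push_cast
    ring
  rw [Ulam, U, h1, Real.rpow_neg (by positivity), ← Real.inv_rpow (by positivity),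
    ← Real.mul_rpow (by positivity) (by positivity)]
  congr 1
  field_simp

theorem Ulam_eq_mul {n : ℕ} {lam r : ℝ} (hlam : 0 < lam) (hr : 0 < r) :
    Ulam n lam r = lam ^ ((n : ℝ) - 2) * (r ^ 2 + lam ^ 4) ^ (-(((n : ℝ) - 2) / 2)) := by
  rw [Ulam_eq hlam hr, Real.div_rpow (by positivity) (by positivity),
    Real.rpow_neg (by positivity), div_eq_mul_inv]
  congr 1
  rw [← Real.rpow_natCast lam 2, ← Real.rpow_mul hlam.le]
  congr 1
  push_cast
  ring

theorem U_pos (n : ℕ) (r : ℝ) : 0 < U n r := by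
  unfold U; positivity

theorem Ulam_pos {n : ℕ} {lam r : ℝ} (hlam : 0 < lam) (hr : 0 < r) : 0 < Ulam n lam r := by
  rw [Ulam_eq hlam hr]; positivity

theorem U_eq {n : ℕ} (r : ℝ) : U n r = (1 / (1 + r ^ 2)) ^ (((n : ℝ) - 2) / 2) := by
  rw [U, Real.rpow_neg (by positivity), one_div, Real.inv_rpow (by positivity)]

theorem rpow_half_rpow {n : ℕ} (hn : 10 ≤ n) {x : ℝ} (hx : 0 ≤ x) :
    (x ^ (((n : ℝ) - 2) / 2)) ^ ((4 : ℝ) / ((n : ℝ) - 2)) = x ^ 2 := by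
  have hn' : (10 : ℝ) ≤ n := by exact_mod_cast hn
  have h : (n : ℝ) - 2 ≠ 0 := by linarith
  rw [← Real.rpow_mul hx, ← Real.rpow_natCast x 2]
  congr 1
  push_cast
  field_simp
  norm_num

theorem Ulam_le {n : ℕ} (hn : 10 ≤ n) {lam r : ℝ} (hlam : 0 < lam) (hr : 0 < r) :
    Ulam n lam r ≤ lam ^ ((n : ℝ) - 2) * (r ^ ((6 : ℝ) - n) / r ^ 4) := by
  have hn' : (10 : ℝ) ≤ n := by exact_mod_cast hn
  rw [Ulam_eq_mul hlam hr]
  have h1 : (r ^ 2 + lam ^ 4) ^ (-(((n : ℝ) - 2) / 2)) ≤ (r ^ 2) ^ (-(((n : ℝ) - 2) / 2)) :=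
    Real.rpow_le_rpow_of_nonpos (by positivity) (by linarith [pow_pos hlam 4]) (by linarith)
  have h2 : (r ^ 2) ^ (-(((n : ℝ) - 2) / 2)) = r ^ ((6 : ℝ) - n) / r ^ 4 := by
    rw [← Real.rpow_natCast r 4, ← Real.rpow_sub hr, ← Real.rpow_natCast r 2,
      ← Real.rpow_mul hr.le]
    congr 1
    push_cast
    ring
  rw [← h2]
  gcongr

/-- The integrand in the definition of `Vlam` is continuous in the parameter `t`. -/
theorem continuous_segment_rpow {n : ℕ} (hn : 10 ≤ n) (x y : ℝ) :
    Continuous fun t : ℝ => (t * x + (1 - t) * y) ^ ((4 : ℝ) / ((n : ℝ) - 2)) := by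
  have hn' : (10 : ℝ) ≤ n := by exact_mod_cast hn
  have h : 0 ≤ (4 : ℝ) / ((n : ℝ) - 2) := div_nonneg (by norm_num) (by linarith)
  exact (Real.continuous_rpow_const h).comp (by fun_prop)

theorem Vlam_le_of_le {n : ℕ} (hn : 10 ≤ n) {lam r x : ℝ} (hx : 0 ≤ x) (hlam : 0 < lam)
    (hr : 0 < r) (h1 : 1 / (1 + r ^ 2) ≤ x) (h2 : lam ^ 2 / (r ^ 2 + lam ^ 4) ≤ x) :
    Vlam n lam r ≤ n * (n + 2) * x ^ 2 := by
  have hn' : (10 : ℝ) ≤ n := by exact_mod_cast hn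
  have hm : 0 ≤ ((n : ℝ) - 2) / 2 := by linarith
  have hα : 0 ≤ (4 : ℝ) / ((n : ℝ) - 2) := div_nonneg (by norm_num) (by linarith)
  have hU : U n r ≤ x ^ (((n : ℝ) - 2) / 2) := by
    rw [U_eq]; gcongr
  have hUl : Ulam n lam r ≤ x ^ (((n : ℝ) - 2) / 2) := by
    rw [Ulam_eq hlam hr]; gcongr
  unfold Vlam
  gcongr
  have h := intervalIntegral.integral_mono_on (μ := MeasureTheory.volume) (a := 0) (b := 1)
    (g := fun _ => (x ^ (((n : ℝ) - 2) / 2)) ^ ((4 : ℝ) / ((n : ℝ) - 2))) zero_le_one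
    ((continuous_segment_rpow hn (U n r) (Ulam n lam r)).intervalIntegrable 0 1)
    intervalIntegrable_const (fun t ht => by
      have h3 := mul_le_mul_of_nonneg_left hU ht.1
      have h4 := mul_le_mul_of_nonneg_left hUl (sub_nonneg.2 ht.2)
      have h5 : 0 ≤ t * U n r + (1 - t) * Ulam n lam r :=
        add_nonneg (mul_nonneg ht.1 (U_pos n r).le)
          (mul_nonneg (sub_nonneg.2 ht.2) (Ulam_pos hlam hr).le)
      exact Real.rpow_le_rpow h5 (by linarith) hα)
  simpa [rpow_half_rpow hn hx] using h

theorem le_Vlam_of_le {n : ℕ} (hn : 10 ≤ n) {lam r x : ℝ} (hx : 0 ≤ x) (hlam : 0 < lam)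
    (hr : 0 < r) (h1 : x ≤ 1 / (1 + r ^ 2)) (h2 : x ≤ lam ^ 2 / (r ^ 2 + lam ^ 4)) :
    n * (n + 2) * x ^ 2 ≤ Vlam n lam r := by
  have hn' : (10 : ℝ) ≤ n := by exact_mod_cast hn
  have hm : 0 ≤ ((n : ℝ) - 2) / 2 := by linarith
  have hα : 0 ≤ (4 : ℝ) / ((n : ℝ) - 2) := div_nonneg (by norm_num) (by linarith)
  have hU : x ^ (((n : ℝ) - 2) / 2) ≤ U n r := by
    rw [U_eq]; gcongr
  have hUl : x ^ (((n : ℝ) - 2) / 2) ≤ Ulam n lam r := by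
    rw [Ulam_eq hlam hr]; gcongr
  unfold Vlam
  gcongr
  have h := intervalIntegral.integral_mono_on (μ := MeasureTheory.volume) (a := 0) (b := 1)
    (f := fun _ => (x ^ (((n : ℝ) - 2) / 2)) ^ ((4 : ℝ) / ((n : ℝ) - 2))) zero_le_one
    intervalIntegrable_const
    ((continuous_segment_rpow hn (U n r) (Ulam n lam r)).intervalIntegrable 0 1) (fun t ht => by
      have h3 := mul_le_mul_of_nonneg_left hU ht.1
      have h4 := mul_le_mul_of_nonneg_left hUl (sub_nonneg.2 ht.2)
      exact Real.rpow_le_rpow (by positivity) (by linarith) hα)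
  simpa [rpow_half_rpow hn hx] using h

theorem Vlam_le {n : ℕ} (hn : 10 ≤ n) {lam r : ℝ} (hlam : 0 < lam) (hr : lam ≤ r) :
    Vlam n lam r ≤ n * (n + 2) * (max 1 (lam ^ 2)) ^ 2 / (r ^ 2 + (max 1 (lam ^ 2)) ^ 2) ^ 2 := by
  have hrpos : 0 < r := hlam.trans_le hr
  have hsq : lam ^ 2 ≤ r ^ 2 := by gcongr
  rw [mul_div_assoc, ← div_pow]
  rcases le_total (lam ^ 2) 1 with h | h
  · rw [max_eq_left h]
    refine Vlam_le_of_le hn (by positivity) hlam hrpos (by rw [one_pow, add_comm]) ?_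
    rw [div_le_div_iff₀ (by positivity) (by positivity)]
    nlinarith [mul_nonneg (sub_nonneg.2 h) (sub_nonneg.2 hsq)]
  · rw [max_eq_right h]
    refine Vlam_le_of_le hn (by positivity) hlam hrpos ?_ (by rw [← pow_mul])
    rw [div_le_div_iff₀ (by positivity) (by positivity)]
    nlinarith [mul_nonneg (sub_nonneg.2 h) (sub_nonneg.2 hsq)]

theorem le_Vlam {n : ℕ} (hn : 10 ≤ n) {lam r η : ℝ} (hlam : 0 < lam) (hr : lam ≤ r)
    (hη : |lam ^ 2 - 1| ≤ η) (hη1 : η ≤ 1) :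
    n * (n + 2) * ((1 - η) * (lam ^ 2 / (r ^ 2 + lam ^ 4))) ^ 2 ≤ Vlam n lam r := by
  have hrpos : 0 < r := hlam.trans_le hr
  have hsq : lam ^ 2 ≤ r ^ 2 := by gcongr
  have hη0 : 0 ≤ η := (abs_nonneg _).trans hη
  have hx : 0 ≤ lam ^ 2 / (r ^ 2 + lam ^ 4) := by positivity
  refine le_Vlam_of_le hn (mul_nonneg (by linarith) hx) hlam hrpos ?_ (by nlinarith)
  rw [mul_div_assoc', div_le_div_iff₀ (by positivity) (by positivity)]
  obtain ⟨h1, h2⟩ := abs_le.1 hη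
  have h3 : (1 - η) * lam ^ 2 ≤ 1 := by nlinarith
  rcases le_total (lam ^ 2) 1 with h | h
  · nlinarith [mul_nonneg (sub_nonneg.2 h) (sub_nonneg.2 hsq), mul_nonneg hη0 (sq_nonneg lam),
      mul_nonneg (mul_nonneg hη0 (sq_nonneg lam)) (sq_nonneg r)]
  · nlinarith [mul_le_mul_of_nonneg_right h3 (sq_nonneg r)]

theorem continuousOn_Ulam {n : ℕ} {lam : ℝ} (hlam : 0 < lam) :
    ContinuousOn (Ulam n lam) (Ioi 0) := by
  have h : ContinuousOn (fun r : ℝ => (lam ^ 2 / (r ^ 2 + lam ^ 4)) ^ (((n : ℝ) - 2) / 2))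
      (Ioi 0) := by
    have hne : ∀ r : ℝ, r ^ 2 + lam ^ 4 ≠ 0 := fun r => by positivity
    have hne' : ∀ r : ℝ, lam ^ 2 / (r ^ 2 + lam ^ 4) ≠ 0 := fun r => by positivity
    refine ContinuousOn.rpow_const ?_ fun r _ => Or.inl (hne' r)
    exact continuousOn_const.div (by fun_prop) fun r _ => hne r
  exact h.congr fun r hr => Ulam_eq hlam hr

theorem contDiffOn_Ulam {n : ℕ} {lam : ℝ} (hlam : 0 < lam) {k : WithTop ℕ∞} :
    ContDiffOn ℝ k (Ulam n lam) (Ioi 0) := by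
  have h : ContDiffOn ℝ k (fun r : ℝ => (lam ^ 2 / (r ^ 2 + lam ^ 4)) ^ (((n : ℝ) - 2) / 2))
      (Ioi 0) := by
    have hne : ∀ r : ℝ, r ^ 2 + lam ^ 4 ≠ 0 := fun r => by positivity
    have hne' : ∀ r : ℝ, lam ^ 2 / (r ^ 2 + lam ^ 4) ≠ 0 := fun r => by positivity
    refine ContDiffOn.rpow_const_of_ne ?_ fun r _ => hne' r
    exact contDiffOn_const.div (by fun_prop) fun r _ => hne r
  exact h.congr fun r hr => Ulam_eq hlam hr

theorem contDiff_U {n : ℕ} {k : WithTop ℕ∞} : ContDiff ℝ k (U n) := by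
  have hne : ∀ r : ℝ, 1 + r ^ 2 ≠ 0 := fun r => by positivity
  exact ContDiff.rpow_const_of_ne (by fun_prop) hne

theorem continuousOn_Vlam {n : ℕ} (hn : 10 ≤ n) {lam : ℝ} (hlam : 0 < lam) :
    ContinuousOn (Vlam n lam) (Ioi 0) := by
  have hn' : (10 : ℝ) ≤ n := by exact_mod_cast hn
  have hα : 0 ≤ (4 : ℝ) / ((n : ℝ) - 2) := div_nonneg (by norm_num) (by linarith)
  rw [continuousOn_iff_continuous_domRestrict]
  have hUl := (continuousOn_iff_continuous_domRestrict.1 (continuousOn_Ulam (n := n) hlam))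
  have hU : Continuous (U n) := (contDiff_U (k := 0)).continuous
  refine continuous_const.mul (intervalIntegral.continuous_parametric_intervalIntegral_of_continuous'
    (f := fun (r : Ioi (0 : ℝ)) (t : ℝ) => (t * U n r + (1 - t) * Ulam n lam r) ^
      ((4 : ℝ) / ((n : ℝ) - 2))) ?_ 0 1)
  refine (Real.continuous_rpow_const hα).comp ?_
  have h1 : Continuous fun z : Ioi (0 : ℝ) × ℝ => U n z.1 :=
    hU.comp (continuous_subtype_val.comp continuous_fst)
  have h2 : Continuous fun z : Ioi (0 : ℝ) × ℝ => Ulam n lam z.1 := hUl.comp continuous_fst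
  exact (continuous_snd.mul h1).add ((continuous_const.sub continuous_snd).mul h2)

/-- Closed form of the average of a power over a segment. -/
theorem integral_segment_rpow {x y α : ℝ} (hxy : x ≠ y) (hα : 0 ≤ α) :
    ∫ t in (0 : ℝ)..1, (t * x + (1 - t) * y) ^ α
      = (x ^ (α + 1) - y ^ (α + 1)) / ((α + 1) * (x - y)) := by
  have hxy' : x - y ≠ 0 := sub_ne_zero.2 hxy
  have h := intervalIntegral.integral_comp_mul_add (a := 0) (b := 1) (fun u : ℝ => u ^ α)
    hxy' y
  rw [show (fun t : ℝ => (t * x + (1 - t) * y) ^ α) = fun t => ((x - y) * t + y) ^ α by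
    funext t; congr 1; ring, h, integral_rpow (Or.inl (by linarith))]
  simp only [mul_zero, zero_add, mul_one, sub_add_cancel, smul_eq_mul]
  field_simp

theorem contDiffOn_Vlam {n : ℕ} (hn : 10 ≤ n) {lam : ℝ} (hlam : 0 < lam) {k : WithTop ℕ∞} :
    ContDiffOn ℝ k (Vlam n lam) (Ioi lam) := by
  have hn' : (10 : ℝ) ≤ n := by exact_mod_cast hn
  have hα : 0 ≤ (4 : ℝ) / ((n : ℝ) - 2) := div_nonneg (by norm_num) (by linarith)
  have hsub : Ioi lam ⊆ Ioi 0 := Ioi_subset_Ioi hlam.le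
  have hU : ContDiffOn ℝ k (U n) (Ioi lam) := contDiff_U.contDiffOn
  have hUl : ContDiffOn ℝ k (Ulam n lam) (Ioi lam) := (contDiffOn_Ulam hlam).mono hsub
  by_cases h1 : lam = 1
  · subst h1
    have h2 : ∀ r ∈ Ioi (1 : ℝ), Vlam n 1 r = n * (n + 2) * U n r ^ ((4 : ℝ) / ((n : ℝ) - 2)) := by
      intro r hr
      have h3 : Ulam n 1 r = U n r := by
        rw [Ulam_eq one_pos (hsub hr), U_eq]
        norm_num [add_comm]
      simp only [Vlam, h3]
      ring_nf
      simp
    exact (contDiffOn_const.mul (hU.rpow_const_of_ne fun r _ => (U_pos n r).ne')).congr h2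
  · have hne : ∀ r ∈ Ioi lam, U n r ≠ Ulam n lam r := by
      intro r hr h2
      have hr0 : 0 < r := hsub hr
      rw [U_eq, Ulam_eq hlam hr0, Real.rpow_left_inj (by positivity) (by positivity)
        (by linarith), div_eq_div_iff (by positivity) (by positivity)] at h2
      have h3 : (1 - lam ^ 2) * (r ^ 2 - lam ^ 2) = 0 := by linear_combination h2
      rcases mul_eq_zero.1 h3 with h4 | h4
      · exact h1 ((sq_eq_sq₀ hlam.le zero_le_one).1 (by linarith))
      · have h5 : r = lam := (sq_eq_sq₀ hr0.le hlam.le).1 (by linarith)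
        exact (ne_of_gt hr) h5
    have hα1 : (4 : ℝ) / ((n : ℝ) - 2) + 1 ≠ 0 := by linarith
    have h2 : ∀ r ∈ Ioi lam, Vlam n lam r = n * (n + 2) *
        ((U n r ^ ((4 : ℝ) / ((n : ℝ) - 2) + 1) - Ulam n lam r ^ ((4 : ℝ) / ((n : ℝ) - 2) + 1)) /
          (((4 : ℝ) / ((n : ℝ) - 2) + 1) * (U n r - Ulam n lam r))) := fun r hr => by
      rw [Vlam, integral_segment_rpow (hne r hr) hα]
    refine (contDiffOn_const.mul (ContDiffOn.div ((hU.rpow_const_of_ne fun r _ => (U_pos n r).ne').sub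
      (hUl.rpow_const_of_ne fun r hr => (Ulam_pos hlam (hsub hr)).ne'))
      (contDiffOn_const.mul (hU.sub hUl)) fun r hr => ?_)).congr h2
    exact mul_ne_zero hα1 (sub_ne_zero.2 (hne r hr))

theorem contDiffOn_of_hasSecondDerivOn {f f1 p q s : ℝ → ℝ} {S : Set ℝ} (hS : IsOpen S)
    (hp : ContDiffOn ℝ (⊤ : ℕ∞) p S) (hq : ContDiffOn ℝ (⊤ : ℕ∞) q S)
    (hs : ContDiffOn ℝ (⊤ : ℕ∞) s S)
    (hf : HasSecondDerivOn f f1 (fun r => s r - p r * f1 r - q r * f r) S) :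
    ContDiffOn ℝ (⊤ : ℕ∞) f S := by
  have hstep : ∀ (g g1 : ℝ → ℝ) (k : ℕ), (∀ r ∈ S, HasDerivAt g (g1 r) r) →
      ContDiffOn ℝ k g1 S → ContDiffOn ℝ ((k + 1 : ℕ) : WithTop ℕ∞) g S := by
    intro g g1 k hg hg1
    rw [Nat.cast_add, Nat.cast_one, contDiffOn_succ_iff_deriv_of_isOpen hS]
    refine ⟨fun r hr => (hg r hr).differentiableAt.differentiableWithinAt, by simp, ?_⟩
    exact hg1.congr fun r hr => (hg r hr).deriv
  have hk : ∀ k : ℕ, ContDiffOn ℝ k f S ∧ ContDiffOn ℝ k f1 S := by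
    intro k
    induction k with
    | zero =>
      simp only [Nat.cast_zero, contDiffOn_zero]
      exact ⟨fun r hr => (hf r hr).1.continuousAt.continuousWithinAt,
        fun r hr => (hf r hr).2.continuousAt.continuousWithinAt⟩
    | succ k ih =>
      have hle : (k : WithTop ℕ∞) ≤ ((⊤ : ℕ∞) : WithTop ℕ∞) := by exact_mod_cast le_top
      exact ⟨hstep f f1 k (fun r hr => (hf r hr).1) ih.2,
        hstep f1 _ k (fun r hr => (hf r hr).2)
          (((hs.of_le hle).sub ((hp.of_le hle).mul ih.2)).sub ((hq.of_le hle).mul ih.1))⟩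
  exact contDiffOn_infty.2 fun k => (hk k).1

theorem hasSecondDerivOn_of_contDiffOn {f : ℝ → ℝ} {S : Set ℝ} (hS : IsOpen S)
    (hf : ContDiffOn ℝ (⊤ : ℕ∞) f S) : HasSecondDerivOn f (deriv f) (deriv (deriv f)) S := by
  have h1 : ContDiffOn ℝ 1 (deriv f) S :=
    ((contDiffOn_succ_iff_deriv_of_isOpen (n := 1) hS).1 (hf.of_le (by norm_cast))).2.2
  have h0 : DifferentiableOn ℝ f S := hf.differentiableOn (by norm_num)
  exact fun r hr => ⟨(h0.differentiableAt (hS.mem_nhds hr)).hasDerivAt,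
    ((h1.differentiableOn (by norm_num)).differentiableAt (hS.mem_nhds hr)).hasDerivAt⟩

theorem IsSolF2lam.hasSecondDerivOn {n : ℕ} {lam : ℝ} {f : ℝ → ℝ} (hf : IsSolF2lam n lam f) :
    HasSecondDerivOn f (deriv f) (deriv (deriv f)) (Ioi lam) :=
  hasSecondDerivOn_of_contDiffOn isOpen_Ioi hf.2.1

/-- A positive strict supersolution of the homogeneous equation, bounded below. -/
theorem exists_positive_supersolution {n : ℕ} (hn : 10 ≤ n) {lam : ℝ} (hlam : 0 < lam) :
    ∃ W W1 W2 : ℝ → ℝ, HasSecondDerivOn W W1 W2 (Ioi 0) ∧ (∀ r ∈ Ici lam, 1 ≤ W r) ∧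
      ∀ r ∈ Ici lam, W2 r + ((n : ℝ) - 1) / r * W1 r + (Vlam n lam r - 2 * n / r ^ 2) * W r < 0 := by
  have hσ : 0 < max 1 (lam ^ 2) := lt_max_of_lt_left one_pos
  obtain ⟨M, hM, h⟩ := exists_supersolution (n := n) hn (q := 0) le_rfl (by simp) hlam hσ
  obtain ⟨g1, g2, hg, hL⟩ := h _ hσ le_rfl
  refine ⟨_, g1, g2, hg, fun r hr => ?_, fun r hr => ?_⟩
  · have hr0 : 0 < r := hlam.trans_le hr
    rw [Real.rpow_zero]
    have : 0 ≤ M * (r * (r ^ 2 + max 1 (lam ^ 2) ^ 2) ^ (-((n : ℝ) / 2))) := by positivity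
    linarith
  · have hr0 : 0 < r := hlam.trans_le hr
    refine (hL r hr _ (Vlam_le hn hlam hr)).trans_lt (neg_neg_of_pos ?_)
    have : (10 : ℝ) ≤ n := by exact_mod_cast hn
    positivity

/-- Comparison principle on `[lam, ∞)`. -/
theorem nonneg_of_supersolution {n : ℕ} (hn : 10 ≤ n) {lam : ℝ} (hlam : 0 < lam)
    {h h1 h2 : ℝ → ℝ} (hc : ContinuousOn h (Ici lam)) (hh : HasSecondDerivOn h h1 h2 (Ioi lam))
    (hLh : ∀ r ∈ Ioi lam,
      h2 r + ((n : ℝ) - 1) / r * h1 r + (Vlam n lam r - 2 * n / r ^ 2) * h r ≤ 0)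
    (ha : 0 ≤ h lam) (hlim : Tendsto h atTop (nhds 0)) : ∀ r ∈ Ici lam, 0 ≤ h r := by
  obtain ⟨W, W1, W2, hW, hW1, hLW⟩ := exists_positive_supersolution hn hlam
  exact nonneg_of_supersolution_Ici (p := fun r => ((n : ℝ) - 1) / r)
    (q := fun r => Vlam n lam r - 2 * n / r ^ 2) one_pos
    (hW.continuousOn.mono (Ici_subset_Ioi.2 hlam)) hW1 (hW.mono (Ioi_subset_Ioi hlam.le))
    (fun r hr => hLW r (Ioi_subset_Ici_self hr)) hc hh hLh ha hlim

theorem source_nonneg {n : ℕ} {lam r : ℝ} (hlam : 0 < lam) (hr : lam ≤ r) :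
    0 ≤ r ^ 2 * Ulam n lam r * (1 - (lam / r) ^ 8) := by
  have hr0 : 0 < r := hlam.trans_le hr
  have h1 : (lam / r) ^ 8 ≤ 1 := pow_le_one₀ (by positivity) ((div_le_one hr0).2 hr)
  exact mul_nonneg (mul_nonneg (by positivity) (Ulam_pos hlam hr0).le) (sub_nonneg.2 h1)

theorem source_le {n : ℕ} (hn : 10 ≤ n) {lam r : ℝ} (hlam : 0 < lam) (hr : 0 < r) :
    r ^ 2 * Ulam n lam r * (1 - (lam / r) ^ 8) ≤
      lam ^ ((n : ℝ) - 2) * (n * r ^ ((6 : ℝ) - n) / r ^ 2) := by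
  have hn' : (10 : ℝ) ≤ n := by exact_mod_cast hn
  have h0 : 0 < r ^ ((6 : ℝ) - n) := by positivity
  have h1 : 0 ≤ (lam / r) ^ 8 := by positivity
  calc r ^ 2 * Ulam n lam r * (1 - (lam / r) ^ 8)
      ≤ r ^ 2 * Ulam n lam r * 1 := by
        have := (Ulam_pos (n := n) hlam hr).le
        gcongr
        linarith
    _ ≤ r ^ 2 * (lam ^ ((n : ℝ) - 2) * (r ^ ((6 : ℝ) - n) / r ^ 4)) := by
        rw [mul_one]
        gcongr
        exact Ulam_le hn hlam hr
    _ = lam ^ ((n : ℝ) - 2) * (1 * r ^ ((6 : ℝ) - n) / r ^ 2) := by field_simp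
    _ ≤ _ := by
        gcongr
        linarith

theorem exists_decaying_supersolution {n : ℕ} (hn : 10 ≤ n) {A r0 S : ℝ} (hA : 0 < A)
    (hr0 : 0 < r0) (hS : 0 < S) :
    ∃ C : ℝ, 0 < C ∧ ∀ lam : ℝ, r0 ≤ lam → max 1 (lam ^ 2) ≤ S → lam ^ ((n : ℝ) - 2) ≤ A →
      ∃ Φ Φ1 Φ2 : ℝ → ℝ, HasSecondDerivOn Φ Φ1 Φ2 (Ioi 0) ∧
        (∀ r ∈ Ici lam, 0 ≤ Φ r ∧ Φ r ≤ C * r ^ ((6 : ℝ) - n)) ∧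
        ∀ r ∈ Ioi lam, Φ2 r + ((n : ℝ) - 1) / r * Φ1 r + (Vlam n lam r - 2 * n / r ^ 2) * Φ r ≤
          -(r ^ 2 * Ulam n lam r * (1 - (lam / r) ^ 8)) := by
  have hn' : (10 : ℝ) ≤ n := by exact_mod_cast hn
  obtain ⟨M, hM, h⟩ := exists_supersolution (n := n) hn (q := 6 - n) (by linarith) (by nlinarith)
    hr0 hS
  refine ⟨A * (1 + M / r0 ^ 5), by positivity, fun lam hlam hσS hlamA => ?_⟩
  have hlam0 : 0 < lam := hr0.trans_le hlam
  have hσ : 0 < max 1 (lam ^ 2) := lt_max_of_lt_left one_pos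
  obtain ⟨g1, g2, hg, hL⟩ := h _ hσ hσS
  refine ⟨_, _, _, hg.const_mul A, fun r hr => ?_, fun r hr => ?_⟩
  · have hrpos : 0 < r := hlam0.trans_le hr
    refine ⟨by positivity, ?_⟩
    rw [mul_assoc]
    gcongr
    have h1 : (r ^ 2 + max 1 (lam ^ 2) ^ 2) ^ (-((n : ℝ) / 2)) ≤ (r ^ 2) ^ (-((n : ℝ) / 2)) :=
      Real.rpow_le_rpow_of_nonpos (by positivity) (by linarith [pow_pos hσ 2]) (by linarith)
    have h2 : r * (r ^ 2) ^ (-((n : ℝ) / 2)) = r ^ ((6 : ℝ) - n) / r ^ 5 := by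
      have h3 : r * r ^ (-(n : ℝ)) = r ^ (1 - (n : ℝ)) := by
        rw [sub_eq_add_neg, Real.rpow_add hrpos, Real.rpow_one]
      rw [← Real.rpow_natCast r 5, ← Real.rpow_sub hrpos, ← Real.rpow_natCast r 2,
        ← Real.rpow_mul hrpos.le]
      push_cast
      rw [show (2 : ℝ) * -(n / 2) = -n by ring, h3]
      congr 1
      ring
    have h3 : r ^ ((6 : ℝ) - n) / r ^ 5 ≤ r ^ ((6 : ℝ) - n) / r0 ^ 5 := by
      have : r0 ≤ r := hlam.trans hr
      gcongr
    have h4 : r * (r ^ 2 + max 1 (lam ^ 2) ^ 2) ^ (-((n : ℝ) / 2)) ≤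
        r ^ ((6 : ℝ) - n) / r0 ^ 5 :=
      (mul_le_mul_of_nonneg_left h1 hrpos.le).trans (h2.trans_le h3)
    calc _ ≤ r ^ ((6 : ℝ) - n) + M * (r ^ ((6 : ℝ) - n) / r0 ^ 5) := by gcongr
      _ = _ := by ring
  · have hrpos : 0 < r := hlam0.trans hr
    have h1 := hL r (hlam.trans (le_of_lt hr)) _ (Vlam_le hn hlam0 (le_of_lt hr))
    have h2 := source_le hn hlam0 hrpos
    have h3 : lam ^ ((n : ℝ) - 2) * (n * r ^ ((6 : ℝ) - n) / r ^ 2) ≤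
        A * (n * r ^ ((6 : ℝ) - n) / r ^ 2) := by gcongr
    have h4 := mul_le_mul_of_nonneg_left h1 hA.le
    calc _ = A * (g2 r + ((n : ℝ) - 1) / r * g1 r + (Vlam n lam r - 2 * n / r ^ 2) *
          (r ^ ((6 : ℝ) - n) + M * (r * (r ^ 2 + max 1 (lam ^ 2) ^ 2) ^ (-((n : ℝ) / 2))))) := by
            ring
      _ ≤ _ := by linarith

theorem tendsto_const_mul_rpow_six_sub {n : ℕ} (hn : 10 ≤ n) (C : ℝ) :
    Tendsto (fun r : ℝ => C * r ^ ((6 : ℝ) - n)) atTop (nhds 0) := by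
  have hn' : (10 : ℝ) ≤ n := by exact_mod_cast hn
  have h := (tendsto_rpow_neg_atTop (y := (n : ℝ) - 6) (by linarith)).const_mul C
  simpa using h

theorem exists_isSolF2lam {n : ℕ} (hn : 10 ≤ n) {lam : ℝ} (hlam : 0 < lam) :
    ∃ f : ℝ → ℝ, IsSolF2lam n lam f := by
  obtain ⟨W, W1, W2, hW, hW1, hLW⟩ := exists_positive_supersolution hn hlam
  obtain ⟨C, hC, hΦex⟩ := exists_decaying_supersolution hn (A := lam ^ ((n : ℝ) - 2)) (r0 := lam)
    (S := max 1 (lam ^ 2)) (by positivity) hlam (lt_max_of_lt_left one_pos)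
  obtain ⟨Φ, Φ1, Φ2, hΦ, hΦb, hLΦ⟩ := hΦex lam le_rfl le_rfl le_rfl
  have hsub : Ici lam ⊆ Ioi 0 := Ici_subset_Ioi.2 hlam
  have hsub' : Ioi lam ⊆ Ioi 0 := Ioi_subset_Ioi hlam.le
  have hne : ∀ r ∈ Ici lam, r ≠ 0 := fun r hr => (hsub hr).ne'
  have hne2 : ∀ r ∈ Ici lam, r ^ 2 ≠ 0 := fun r hr => pow_ne_zero 2 (hne r hr)
  have hp : ContDiffOn ℝ (⊤ : ℕ∞) (fun r : ℝ => ((n : ℝ) - 1) / r) (Ici lam) :=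
    contDiffOn_const.div contDiffOn_id hne
  have hrat : ContDiffOn ℝ (⊤ : ℕ∞) (fun r : ℝ => 2 * (n : ℝ) / r ^ 2) (Ici lam) :=
    contDiffOn_const.div (by fun_prop) hne2
  have hs : ContDiffOn ℝ (⊤ : ℕ∞) (fun r => -(r ^ 2 * Ulam n lam r * (1 - (lam / r) ^ 8)))
      (Ici lam) := by
    have h1 : ContDiffOn ℝ (⊤ : ℕ∞) (fun r : ℝ => lam / r) (Ici lam) :=
      contDiffOn_const.div contDiffOn_id hne
    exact (((by fun_prop : ContDiffOn ℝ (⊤ : ℕ∞) (fun r : ℝ => r ^ 2) (Ici lam)).mul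
      ((contDiffOn_Ulam hlam).mono hsub)).mul (contDiffOn_const.sub (h1.pow 8))).neg
  obtain ⟨f, f1, hfc, hf, hf0, hfb⟩ := exists_bvp_solution (a := lam)
    (p := fun r => ((n : ℝ) - 1) / r) (q := fun r => Vlam n lam r - 2 * (n : ℝ) / r ^ 2)
    (s := fun r => -(r ^ 2 * Ulam n lam r * (1 - (lam / r) ^ 8))) hp.continuousOn
    (((continuousOn_Vlam hn hlam).mono hsub).sub hrat.continuousOn) hs.continuousOn
    (fun r hr => neg_nonpos.2 (source_nonneg hlam (le_of_lt hr)))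
    (hW.continuousOn.mono hsub) (fun r hr => one_pos.trans_le (hW1 r hr)) (hW.mono hsub')
    (fun r hr => hLW r (Ioi_subset_Ici_self hr)) (hΦ.continuousOn.mono hsub) (fun r hr => (hΦb r hr).1)
    (hΦ.mono hsub') hLΦ
  have hsm := contDiffOn_of_hasSecondDerivOn isOpen_Ioi (hp.mono Ioi_subset_Ici_self)
    ((contDiffOn_Vlam hn hlam).sub (hrat.mono Ioi_subset_Ici_self))
    (hs.mono Ioi_subset_Ici_self) hf
  refine ⟨f, hfc, hsm, fun r hr => ?_, hf0, ?_⟩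
  · have hd : deriv f r = f1 r := (hf r hr).1.deriv
    have hev : deriv f =ᶠ[nhds r] f1 := by
      filter_upwards [isOpen_Ioi.mem_nhds hr] with x hx using (hf x hx).1.deriv
    rw [hev.deriv_eq, (hf r hr).2.deriv, hd]
    ring
  · refine tendsto_of_tendsto_of_tendsto_of_le_of_le' tendsto_const_nhds
      (tendsto_const_mul_rpow_six_sub hn C) ?_ ?_
    · filter_upwards [eventually_ge_atTop lam] with r hr using (hfb r hr).1
    · filter_upwards [eventually_ge_atTop lam] with r hr
      exact (hfb r hr).2.trans (hΦb r hr).2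

/-- Comparison of two solutions. -/
theorem IsSolF2lam.le {n : ℕ} (hn : 10 ≤ n) {lam : ℝ} (hlam : 0 < lam) {f g : ℝ → ℝ}
    (hf : IsSolF2lam n lam f) (hg : IsSolF2lam n lam g) : ∀ r ∈ Ici lam, f r ≤ g r := by
  intro r hr
  refine sub_nonneg.1 (nonneg_of_supersolution hn hlam (h := fun r => g r - f r) (hg.1.sub hf.1)
    (hg.hasSecondDerivOn.sub hf.hasSecondDerivOn) (fun x hx => ?_) ?_ ?_ r hr)
  · have h1 := hf.2.2.1 x hx
    have h2 := hg.2.2.1 x hx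
    linarith
  · rw [hf.2.2.2.1, hg.2.2.2.1, sub_self]
  · simpa using hg.2.2.2.2.sub hf.2.2.2.2

theorem IsSolF2lam.nonneg {n : ℕ} (hn : 10 ≤ n) {lam : ℝ} (hlam : 0 < lam) {f : ℝ → ℝ}
    (hf : IsSolF2lam n lam f) : ∀ r ∈ Ici lam, 0 ≤ f r :=
  nonneg_of_supersolution hn hlam hf.1 hf.hasSecondDerivOn
    (fun r hr => (hf.2.2.1 r hr).trans_le (neg_nonpos.2 (source_nonneg hlam (le_of_lt hr))))
    hf.2.2.2.1.ge hf.2.2.2.2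

theorem exists_uniform_upper_bound {n : ℕ} (hn : 10 ≤ n) :
    ∃ C : ℝ, 0 < C ∧ ∀ lam : ℝ, |lam - 1| ≤ 1 / 2 → ∀ f : ℝ → ℝ, IsSolF2lam n lam f →
      ∀ r ∈ Ici lam, f r ≤ C * r ^ ((6 : ℝ) - n) := by
  have hn' : (10 : ℝ) ≤ n := by exact_mod_cast hn
  obtain ⟨C, hC, hΦex⟩ := exists_decaying_supersolution hn (A := 2 ^ ((n : ℝ) - 2)) (r0 := 1 / 2)
    (S := 4) (by positivity) (by norm_num) (by norm_num)
  refine ⟨C, hC, fun lam hlam1 f hf r hr => ?_⟩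
  obtain ⟨h1, h2⟩ := abs_le.1 hlam1
  have hlam : 0 < lam := by linarith
  obtain ⟨Φ, Φ1, Φ2, hΦ, hΦb, hLΦ⟩ := hΦex lam (by linarith)
    (max_le (by norm_num) (by nlinarith))
    (Real.rpow_le_rpow hlam.le (by linarith) (by linarith))
  refine le_trans (sub_nonneg.1 ?_) (hΦb r hr).2
  refine nonneg_of_supersolution hn hlam (h := fun r => Φ r - f r)
    ((hΦ.continuousOn.mono (Ici_subset_Ioi.2 hlam)).sub hf.1)
    ((hΦ.mono (Ioi_subset_Ioi hlam.le)).sub hf.hasSecondDerivOn) (fun x hx => ?_) ?_ ?_ r hr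
  · have h3 := hf.2.2.1 x hx
    have h4 := hLΦ x hx
    linarith
  · rw [hf.2.2.2.1, sub_zero]
    exact (hΦb lam self_mem_Ici).1
  · have h3 : Tendsto Φ atTop (nhds 0) := by
      refine tendsto_of_tendsto_of_tendsto_of_le_of_le' tendsto_const_nhds
        (tendsto_const_mul_rpow_six_sub hn C) ?_ ?_
      · filter_upwards [eventually_ge_atTop lam] with r hr using (hΦb r hr).1
      · filter_upwards [eventually_ge_atTop lam] with r hr using (hΦb r hr).2
    simpa using h3.sub hf.2.2.2.2

theorem hasSecondDerivOn_laurent (c4 c2 c0 d2 d4 : ℝ) :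
    HasSecondDerivOn (fun r => c4 * r ^ 4 + c2 * r ^ 2 + c0 + d2 / r ^ 2 + d4 / r ^ 4)
      (fun r => 4 * c4 * r ^ 3 + 2 * c2 * r - 2 * d2 / r ^ 3 - 4 * d4 / r ^ 5)
      (fun r => 12 * c4 * r ^ 2 + 2 * c2 + 6 * d2 / r ^ 4 + 20 * d4 / r ^ 6) (Ioi 0) := by
  intro r hr
  have hr0 : r ≠ 0 := (mem_Ioi.1 hr).ne'
  have hinv : ∀ (d : ℝ) (k : ℕ), HasDerivAt (fun r : ℝ => d / r ^ (k + 1))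
      (-((k + 1) * d / r ^ (k + 2))) r := by
    intro d k
    refine (((hasDerivAt_pow (k + 1) r).inv (pow_ne_zero _ hr0)).const_mul d).congr_deriv ?_
    push_cast
    field_simp
    ring
  constructor
  · refine ((((((hasDerivAt_pow 4 r).const_mul c4).add ((hasDerivAt_pow 2 r).const_mul c2)).add_const
      c0).add (hinv d2 1)).add (hinv d4 3)).congr_deriv ?_
    push_cast
    ring
  · refine ((((((hasDerivAt_pow 3 r).const_mul (4 * c4)).add ((hasDerivAt_id r).const_mul (2 * c2))).sub
      (hinv (2 * d2) 2)).sub (hinv (4 * d4) 4))).congr_deriv ?_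
    push_cast
    ring

/-- The exact action of the linearized operator at `λ = 1` on the leading profile. -/
theorem profile_identity {n x : ℝ} (hn : 10 ≤ n) (hx : 1 ≤ x) :
    -(6 * (n - 4)) * (x ^ 2 - 1 / x ^ 2) ≤
      16 * (x ^ 2 - 1 / x ^ 2) - 4 * (n - 2) * ((x - 1) / (x + 1)) * (x ^ 2 + 1 / x ^ 2)
        - n * (1 + ((x - 1) / (x + 1)) ^ 2) * (x ^ 2 - 1 / x ^ 2)
        + (3 * n - 4) / (n - 2) * (4 * (x - 1 / x)
          - 2 * (n - 2) * ((x - 1) / (x + 1)) * (x + 1 / x)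
          - n * (1 + ((x - 1) / (x + 1)) ^ 2) * (x - 1 / x)) := by
  have hx0 : 0 < x := by linarith
  have hn2 : n - 2 ≠ 0 := by linarith
  have h1 : 0 ≤ (x - 1) / (x + 1) := div_nonneg (by linarith) (by linarith)
  have h2 : 0 ≤ 4 * (2 * n * (n - 1) / (n - 2)) * ((x - 1) / (x + 1)) :=
    mul_nonneg (mul_nonneg (by norm_num) (div_nonneg (by nlinarith) (by linarith))) h1
  rw [← sub_nonneg]
  refine h2.trans_eq ?_
  field_simp
  ring

/-- Stability of the profile inequality under small perturbations of the coefficients. -/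
theorem profile_perturbation {n η ρ τ a b ν P₁ P₂ E₁ E₂ : ℝ} (hn : 10 ≤ n) (hη : 0 ≤ η)
    (hρτ : |ρ - τ| ≤ η) (hρ : |ρ| ≤ 1) (hτ : |τ| ≤ 1) (hb : |b| ≤ 8) (hba : |b - a| ≤ 8 * η)
    (hν : |ν| ≤ η * (n * (n + 2) / 2)) (hP₁ : |P₁| ≤ E₂) (hP₂ : |P₂| ≤ E₂) (hE₁ : |E₁| ≤ E₂) :
    16 * P₂ - 4 * (n - 2) * τ * E₂ - n * (1 + τ ^ 2) * P₂
        + a * (4 * P₁ - 2 * (n - 2) * τ * E₁ - n * (1 + τ ^ 2) * P₁) - 13 * n ^ 2 * η * E₂ ≤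
      16 * P₂ - 4 * (n - 2) * ρ * E₂ + (-n * (1 + ρ ^ 2) - ν) * P₂
        + b * (4 * P₁ - 2 * (n - 2) * ρ * E₁ + (-n * (1 + ρ ^ 2) - ν) * P₁) := by
  have hE₂ : 0 ≤ E₂ := (abs_nonneg _).trans hP₂
  have hmul : ∀ {u v A B : ℝ}, |u| ≤ A → |v| ≤ B → |u * v| ≤ A * B := fun hu hv => by
    rw [abs_mul]
    exact mul_le_mul hu hv (abs_nonneg _) ((abs_nonneg _).trans hu)
  have hadd : |ρ + τ| ≤ 2 := (abs_add_le _ _).trans (by linarith)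
  have hτ2 : |τ ^ 2| ≤ 1 := by rw [abs_pow]; exact pow_le_one₀ (abs_nonneg _) hτ
  have hsq : |(ρ - τ) * (ρ + τ)| ≤ η * 2 := hmul hρτ hadd
  have hEE : |E₂| ≤ E₂ := (abs_of_nonneg hE₂).le
  have t1 := abs_le.1 (hmul hρτ hEE)
  have t2 := abs_le.1 (hmul hsq hP₂)
  have t3 := abs_le.1 (hmul hν hP₂)
  have t4 := abs_le.1 (hmul hba hP₁)
  have t5 := abs_le.1 (hmul hba (hmul hτ hE₁))
  have t6 := abs_le.1 (hmul hba (hmul hτ2 hP₁))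
  have t7 := abs_le.1 (hmul hb (hmul hρτ hE₁))
  have t8 := abs_le.1 (hmul hb (hmul hsq hP₁))
  have t9 := abs_le.1 (hmul hb (hmul hν hP₁))
  have hX : 0 ≤ η * E₂ := mul_nonneg hη hE₂
  have hn0 : 0 ≤ n := by linarith
  have hn2 : 0 ≤ n - 2 := by linarith
  have s1 := mul_le_mul_of_nonneg_left t1.2 hn2
  have s2 := mul_le_mul_of_nonneg_left t2.2 hn0
  have s4 := mul_le_mul_of_nonneg_left t4.2 hn0
  have s5 := mul_le_mul_of_nonneg_left t5.2 hn2
  have s6 := mul_le_mul_of_nonneg_left t6.2 hn0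
  have s7 := mul_le_mul_of_nonneg_left t7.2 hn2
  have s8 := mul_le_mul_of_nonneg_left t8.2 hn0
  have hfin : 0 ≤ (n ^ 2 * 13 - (9 / 2 * n ^ 2 + 79 * n + 32)) * (η * E₂) :=
    mul_nonneg (by nlinarith) hX
  linarith [mul_nonneg hn0 hX]

set_option maxHeartbeats 1000000 in
theorem subsolution_inequality {n x μ ε ρ ν a κ c : ℝ} (hn : 10 ≤ n) (hx : 1 ≤ x)
    (hε : 0 ≤ ε) (hε1 : ε ≤ 1) (hμ : |μ - 1| ≤ 3 * ε / n ^ 3)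
    (hρ : ρ = (x - μ) / (x + μ)) (hν : 0 ≤ ν) (hν1 : ν ≤ 3 * ε / n ^ 3 * (n * (n + 2) / 2))
    (ha : a = (3 * n - 4) / (n - 2)) (hκ : κ = ε / (7 * n)) (hc : c = (1 - ε) / (6 * (n - 4))) :
    0 ≤ c * (16 * (x ^ 2 - 1 / x ^ 2) - 4 * (n - 2) * ρ * (x ^ 2 + 1 / x ^ 2)
          + (-n * (1 + ρ ^ 2) - ν) * (x ^ 2 - 1 / x ^ 2)
        + a / μ * (4 * (x - 1 / x) - 2 * (n - 2) * ρ * (x + 1 / x)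
          + (-n * (1 + ρ ^ 2) - ν) * (x - 1 / x)))
      + κ * (16 * (x ^ 2 + 1 / x ^ 2) - 4 * (n - 2) * ρ * (x ^ 2 - 1 / x ^ 2)
          + (-n * (1 + ρ ^ 2) - ν) * (x ^ 2 + 1 / x ^ 2 - 2))
      + (x ^ 2 - 1 / x ^ 2) := by
  have hx0 : 0 < x := by linarith
  have hn0 : 0 < n := by linarith
  set η : ℝ := 3 * ε / n ^ 3 with hη
  have hη0 : 0 ≤ η := by positivity
  have hη1 : η * n ^ 3 = 3 * ε := by rw [hη]; field_simp
  have hn3 : 1000 ≤ n ^ 3 := by linarith [pow_le_pow_left₀ (by norm_num) hn 3]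
  have hη2 : η ≤ 3 / 1000 := by
    rw [hη, div_le_div_iff₀ (by positivity) (by norm_num)]
    linarith
  obtain ⟨hμ1, hμ2⟩ := abs_le.1 hμ
  have hμ0 : 0 < μ := by linarith
  have hinv : 1 / x ≤ 1 := (div_le_one hx0).2 hx
  have hinv0 : 0 < 1 / x := by positivity
  have hinv2 : 1 / x ^ 2 = (1 / x) ^ 2 := by rw [div_pow, one_pow]
  have hinv2' : 1 / x ^ 2 ≤ 1 := by rw [hinv2]; nlinarith
  have hinv2p : 0 < 1 / x ^ 2 := by positivity
  have hxx : x ≤ x ^ 2 := by nlinarith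
  have hprod : x * (1 / x) = 1 := by field_simp
  have hE : x + 1 / x ≤ x ^ 2 + 1 / x ^ 2 := by
    rw [hinv2]
    nlinarith [mul_nonneg (sub_nonneg.2 hx) (sub_nonneg.2 hx), sq_nonneg (x + 1 / x - 2)]
  have hρ1 : |ρ| ≤ 1 := by
    rw [hρ, abs_div, abs_of_pos (by linarith : 0 < x + μ), div_le_one (by linarith), abs_le]
    constructor <;> linarith
  have hτ1 : |(x - 1) / (x + 1)| ≤ 1 := by
    rw [abs_div, abs_of_pos (by linarith : 0 < x + 1), div_le_one (by linarith), abs_le]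
    constructor <;> linarith
  have hρτ : |ρ - (x - 1) / (x + 1)| ≤ η := by
    have h1 : ρ - (x - 1) / (x + 1) = (1 - μ) * (2 * x / ((x + μ) * (x + 1))) := by
      rw [hρ]
      field_simp
      ring
    have h2 : 2 * x / ((x + μ) * (x + 1)) ≤ 1 := by
      rw [div_le_one (by positivity)]
      nlinarith
    have h3 : 0 ≤ 2 * x / ((x + μ) * (x + 1)) := by positivity
    rw [h1, abs_mul, abs_of_nonneg h3, abs_sub_comm]
    exact (mul_le_of_le_one_right (abs_nonneg _) h2).trans hμ
  have ha0 : 0 ≤ a := by rw [ha]; exact div_nonneg (by linarith) (by linarith)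
  have ha4 : a ≤ 4 * (99 / 100) := by
    rw [ha, div_le_iff₀ (by linarith)]
    linarith
  have hdiv : a / μ * μ = a := by field_simp
  have hb0 : 0 ≤ a / μ := by positivity
  have hb8 : a / μ ≤ 8 := by
    rw [div_le_iff₀ hμ0]
    linarith
  have hba : |a / μ - a| ≤ 8 * η := by
    have h1 : a / μ - a = a / μ * (1 - μ) := by rw [mul_sub, hdiv, mul_one]
    rw [h1, abs_mul, abs_of_nonneg hb0, abs_sub_comm]
    exact mul_le_mul hb8 hμ (abs_nonneg _) (by norm_num)
  have hpert := profile_perturbation (n := n) (η := η) (ρ := ρ) (τ := (x - 1) / (x + 1)) (a := a)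
    (b := a / μ) (ν := ν) (P₁ := x - 1 / x) (P₂ := x ^ 2 - 1 / x ^ 2) (E₁ := x + 1 / x)
    (E₂ := x ^ 2 + 1 / x ^ 2) hn hη0 hρτ hρ1 hτ1 (by rw [abs_of_nonneg hb0]; exact hb8) hba
    (by rw [abs_of_nonneg hν]; exact hν1) (by rw [abs_le]; constructor <;> linarith)
    (by rw [abs_le]; constructor <;> linarith) (by rw [abs_le]; constructor <;> linarith)
  have hid := profile_identity (n := n) hn hx
  rw [← ha] at hid
  have hc0 : 0 ≤ c := by rw [hc]; exact div_nonneg (by linarith) (by linarith)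
  have hc1 : c * (6 * (n - 4)) = 1 - ε := by
    have : n - 4 ≠ 0 := by linarith
    rw [hc]; field_simp
  have hc36 : c * 36 ≤ 1 := by
    have := mul_le_mul_of_nonneg_left (by linarith : (36 : ℝ) ≤ 6 * (n - 4)) hc0
    linarith
  have hκ0 : 0 ≤ κ := by rw [hκ]; positivity
  have hκ1 : κ * (7 * n) = ε := by rw [hκ]; field_simp
  set E : ℝ := x ^ 2 + 1 / x ^ 2 with hEdef
  set P : ℝ := x ^ 2 - 1 / x ^ 2 with hPdef
  have hP0 : 0 ≤ P := by linarith
  have hE0 : 0 < E := by positivity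
  have hmain := mul_le_mul_of_nonneg_left ((sub_le_sub_right hid (13 * n ^ 2 * η * E)).trans hpert)
    hc0
  have hE2 : 0 ≤ E - 2 := by
    rw [hEdef, hinv2]
    nlinarith [sq_nonneg (x - 1 / x)]
  have hEP : E - 2 ≤ P := by linarith
  have hν2 : ν ≤ n := by
    refine hν1.trans ?_
    rw [div_mul_eq_mul_div, div_le_iff₀ (by positivity)]
    have h1 := mul_le_mul_of_nonneg_right hε1 (by positivity : 0 ≤ n * (n + 2))
    have h2 : n * (n + 2) ≤ n * n * 2 := by
      linarith [mul_le_mul_of_nonneg_left hn hn0.le]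
    have h3 : n * n * 3 ≤ n * n * n ^ 2 := by
      gcongr
      linarith [pow_le_pow_left₀ (by norm_num) hn 2]
    linarith
  have hρle := (abs_le.1 hρ1).2
  have hρsq : ρ ^ 2 ≤ 1 := by rw [← sq_abs]; exact pow_le_one₀ (abs_nonneg _) hρ1
  have hκpart : κ * (16 * E - 7 * n * P) ≤ κ * (16 * E - 4 * (n - 2) * ρ * P
      + (-n * (1 + ρ ^ 2) - ν) * (E - 2)) := by
    refine mul_le_mul_of_nonneg_left ?_ hκ0
    have h1 : (n - 2) * ρ * P ≤ n * P := by
      refine mul_le_mul_of_nonneg_right ?_ hP0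
      linarith [mul_le_mul_of_nonneg_left hρle (by linarith : 0 ≤ n - 2)]
    have h2 : (n * (1 + ρ ^ 2) + ν) * (E - 2) ≤ (3 * n) * P := by
      refine mul_le_mul ?_ hEP hE2 (by linarith)
      linarith [mul_le_mul_of_nonneg_left hρsq hn0.le]
    linarith
  have hηκ : c * (13 * n ^ 2 * η) ≤ κ * 16 := by
    have h1 : c * (13 * n ^ 2 * η) * n ≤ κ * 16 * n := by
      have h2 : c * (13 * n ^ 2 * η) * n = c * 39 * ε := by linear_combination 13 * c * hη1
      have h3 : κ * 16 * n = 16 / 7 * ε := by linear_combination 16 / 7 * hκ1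
      rw [h2, h3]
      linarith [mul_le_mul_of_nonneg_right hc36 hε]
    exact le_of_mul_le_mul_right h1 hn0
  have hfin := mul_le_mul_of_nonneg_right hηκ hE0.le
  have e1 : c * (-(6 * (n - 4)) * P - 13 * n ^ 2 * η * E) =
      -(1 - ε) * P - c * (13 * n ^ 2 * η) * E := by linear_combination (-P) * hc1
  have e2 : κ * (16 * E - 7 * n * P) = κ * 16 * E - ε * P := by linear_combination (-P) * hκ1
  linarith

/-- The linearized operator applied to `B p`, with `B` a bubble of scale `l ^ 2`. -/
theorem bubble_mul_operator {n r l B p p1 p2 w : ℝ} (hr : 0 < r) (hl : 0 < l) :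
    r ^ 2 * ((2 * (-((n - 2) / 2)) / (r ^ 2 + l ^ 4) + 4 * (-((n - 2) / 2)) *
          (-((n - 2) / 2) - 1) * r ^ 2 / (r ^ 2 + l ^ 4) ^ 2) * B * p
        + 2 * (2 * (-((n - 2) / 2)) * r * B / (r ^ 2 + l ^ 4) * p1) + B * p2
        + (n - 1) / r * (2 * (-((n - 2) / 2)) * r * B / (r ^ 2 + l ^ 4) * p + B * p1)
        + (n * (n + 2) * (w * (l ^ 2 / (r ^ 2 + l ^ 4))) ^ 2 - 2 * n / r ^ 2) * (B * p))
      = B * (r ^ 2 * p2 + r * p1 - (n - 2) * ((r ^ 2 - l ^ 4) / (r ^ 2 + l ^ 4)) * (r * p1)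
        + (-n * (1 + ((r ^ 2 - l ^ 4) / (r ^ 2 + l ^ 4)) ^ 2)
          - n * (n + 2) * (1 - w ^ 2) * (1 - ((r ^ 2 - l ^ 4) / (r ^ 2 + l ^ 4)) ^ 2) / 4) * p) := by
  have h : r ^ 2 + l ^ 4 ≠ 0 := by positivity
  field_simp
  ring

theorem subsolution_operator_nonneg {n l r ε a κ c B p p1 p2 : ℝ} (hn : 10 ≤ n) (hl : 0 < l)
    (hr : l ≤ r) (hε : 0 ≤ ε) (hε1 : ε ≤ 1) (hμ : |l ^ 2 - 1| ≤ 3 * ε / n ^ 3) (hB : 0 ≤ B)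
    (ha : a = (3 * n - 4) / (n - 2)) (hκ : κ = ε / (7 * n)) (hc : c = (1 - ε) / (6 * (n - 4)))
    (hp : p = c * (r ^ 4 - l ^ 8 / r ^ 4 + a * (r ^ 2 - l ^ 4 / r ^ 2))
      + κ * (r ^ 4 + l ^ 8 / r ^ 4 - 2 * l ^ 4))
    (hp1 : r * p1 = c * (4 * (r ^ 4 + l ^ 8 / r ^ 4) + a * (2 * (r ^ 2 + l ^ 4 / r ^ 2)))
      + κ * (4 * (r ^ 4 - l ^ 8 / r ^ 4)))
    (hp2 : r ^ 2 * p2 + r * p1 = c * (16 * (r ^ 4 - l ^ 8 / r ^ 4)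
      + a * (4 * (r ^ 2 - l ^ 4 / r ^ 2))) + κ * (16 * (r ^ 4 + l ^ 8 / r ^ 4))) :
    0 ≤ (2 * (-((n - 2) / 2)) / (r ^ 2 + l ^ 4) + 4 * (-((n - 2) / 2)) *
          (-((n - 2) / 2) - 1) * r ^ 2 / (r ^ 2 + l ^ 4) ^ 2) * B * p
        + 2 * (2 * (-((n - 2) / 2)) * r * B / (r ^ 2 + l ^ 4) * p1) + B * p2
        + (n - 1) / r * (2 * (-((n - 2) / 2)) * r * B / (r ^ 2 + l ^ 4) * p + B * p1)
        + (n * (n + 2) * ((1 - 3 * ε / n ^ 3) * (l ^ 2 / (r ^ 2 + l ^ 4))) ^ 2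
          - 2 * n / r ^ 2) * (B * p) + r ^ 2 * B * (1 - (l / r) ^ 8) := by
  have hr0 : 0 < r := hl.trans_le hr
  have hη0 : 0 ≤ 3 * ε / n ^ 3 := by positivity
  refine nonneg_of_mul_nonneg_right ?_ (pow_pos hr0 2)
  rw [mul_add, bubble_mul_operator hr0 hl]
  set η : ℝ := 3 * ε / n ^ 3 with hη
  set ρ : ℝ := (r ^ 2 - l ^ 4) / (r ^ 2 + l ^ 4) with hρ
  set ν : ℝ := n * (n + 2) * (1 - (1 - η) ^ 2) * (1 - ρ ^ 2) / 4 with hν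
  have hρ2 : 1 - ρ ^ 2 = 4 * r ^ 2 * l ^ 4 / (r ^ 2 + l ^ 4) ^ 2 := by
    rw [hρ]
    field_simp
    ring
  have hη1 : η ≤ 1 := by
    rw [hη, div_le_one (by positivity)]
    have := pow_le_pow_left₀ (by norm_num) hn 3
    linarith
  have hn0 : 0 < n := by linarith
  have hρ0 : 0 ≤ 1 - ρ ^ 2 := by rw [hρ2]; positivity
  have hν0 : 0 ≤ ν := by
    have : 0 ≤ 1 - (1 - η) ^ 2 := by nlinarith
    positivity
  have hν1 : ν ≤ η * (n * (n + 2) / 2) := by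
    have h1 : (1 - (1 - η) ^ 2) * (1 - ρ ^ 2) ≤ 2 * η * 1 :=
      mul_le_mul (by nlinarith) (by nlinarith [sq_nonneg ρ]) hρ0 (by linarith)
    have h2 := mul_le_mul_of_nonneg_left h1 (by positivity : 0 ≤ n * (n + 2))
    rw [hν]
    linarith
  have hx : 1 ≤ r ^ 2 / l ^ 2 := by
    rw [one_le_div (by positivity)]
    gcongr
  have hρ' : ρ = (r ^ 2 / l ^ 2 - l ^ 2) / (r ^ 2 / l ^ 2 + l ^ 2) := by
    rw [hρ]
    field_simp
  have key := subsolution_inequality hn hx hε hε1 hμ hρ' hν0 hν1 ha hκ hc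
  have hpow : r ^ 4 * (1 - (l / r) ^ 8) = r ^ 4 - l ^ 8 / r ^ 4 := by
    field_simp
  have hq1 : r ^ 2 / l ^ 2 - 1 / (r ^ 2 / l ^ 2) = (r ^ 2 - l ^ 4 / r ^ 2) / l ^ 2 := by
    field_simp
  have hq2 : r ^ 2 / l ^ 2 + 1 / (r ^ 2 / l ^ 2) = (r ^ 2 + l ^ 4 / r ^ 2) / l ^ 2 := by
    field_simp
  have hq3 : (r ^ 2 / l ^ 2) ^ 2 - 1 / (r ^ 2 / l ^ 2) ^ 2 = (r ^ 4 - l ^ 8 / r ^ 4) / l ^ 4 := by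
    field_simp
  have hq4 : (r ^ 2 / l ^ 2) ^ 2 + 1 / (r ^ 2 / l ^ 2) ^ 2 = (r ^ 4 + l ^ 8 / r ^ 4) / l ^ 4 := by
    field_simp
  rw [hq1, hq2, hq3, hq4] at key
  have key' := mul_nonneg (mul_nonneg hB (by positivity : 0 ≤ l ^ 4)) key
  refine key'.trans_eq ?_
  rw [hp2, hp1, hp]
  have e1 : r ^ 2 * (r ^ 2 * B * (1 - (l / r) ^ 8)) = B * (r ^ 4 - l ^ 8 / r ^ 4) := by
    rw [← hpow]; ring
  rw [e1]
  generalize r ^ 4 - l ^ 8 / r ^ 4 = X1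
  generalize r ^ 4 + l ^ 8 / r ^ 4 = X2
  generalize r ^ 2 - l ^ 4 / r ^ 2 = X3
  generalize r ^ 2 + l ^ 4 / r ^ 2 = X4
  clear_value ρ ν
  field_simp
  ring

theorem IsSolF2lam.lower_bound {n : ℕ} (hn : 10 ≤ n) {lam ε : ℝ} (hlam : 0 < lam) (hε : 0 ≤ ε)
    (hε1 : ε ≤ 1) (hμ : |lam ^ 2 - 1| ≤ 3 * ε / (n : ℝ) ^ 3) {f : ℝ → ℝ}
    (hf : IsSolF2lam n lam f) : ∀ r ∈ Ici lam,
      (1 - ε) / (6 * ((n : ℝ) - 4)) * Ulam n lam r *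
          (r ^ 4 * (1 - (lam / r) ^ 8)
            + (3 * (n : ℝ) - 4) / ((n : ℝ) - 2) * r ^ 2 * (1 - (lam / r) ^ 4)) ≤ f r := by
  have hn' : (10 : ℝ) ≤ n := by exact_mod_cast hn
  set a : ℝ := (3 * (n : ℝ) - 4) / ((n : ℝ) - 2) with ha
  set κ : ℝ := ε / (7 * n) with hκ
  set c : ℝ := (1 - ε) / (6 * ((n : ℝ) - 4)) with hc
  have ha0 : 0 ≤ a := by rw [ha]; exact div_nonneg (by linarith) (by linarith)
  have hκ0 : 0 ≤ κ := by positivity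
  have hc0 : 0 ≤ c := by rw [hc]; exact div_nonneg (by linarith) (by linarith)
  have hη1 : 3 * ε / (n : ℝ) ^ 3 ≤ 1 := by
    rw [div_le_one (by positivity)]
    have := pow_le_pow_left₀ (by norm_num) hn' 3
    linarith
  have hP := (hasSecondDerivOn_laurent (c + κ) (c * a) (-(2 * κ * lam ^ 4)) (-(c * a * lam ^ 4))
    ((κ - c) * lam ^ 8))
  have hB := (hasSecondDerivOn_sq_add_rpow (pow_pos hlam 4) (-(((n : ℝ) - 2) / 2))).mono
    (subset_univ (Ioi 0))
  have hφ := (hB.mul hP).const_mul (lam ^ ((n : ℝ) - 2))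
  have hpoly : ∀ r : ℝ, 0 < r → (c + κ) * r ^ 4 + c * a * r ^ 2 + -(2 * κ * lam ^ 4)
      + -(c * a * lam ^ 4) / r ^ 2 + (κ - c) * lam ^ 8 / r ^ 4 =
      c * (r ^ 4 - lam ^ 8 / r ^ 4 + a * (r ^ 2 - lam ^ 4 / r ^ 2))
      + κ * (r ^ 4 + lam ^ 8 / r ^ 4 - 2 * lam ^ 4) := fun r hr => by ring
  have hg : ∀ r : ℝ, 0 < r → r ^ 4 - lam ^ 8 / r ^ 4 + a * (r ^ 2 - lam ^ 4 / r ^ 2) =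
      r ^ 4 * (1 - (lam / r) ^ 8) + a * r ^ 2 * (1 - (lam / r) ^ 4) := fun r hr => by field_simp
  have hsq : ∀ r : ℝ, 0 < r → 0 ≤ r ^ 4 + lam ^ 8 / r ^ 4 - 2 * lam ^ 4 := fun r hr => by
    have : r ^ 4 + lam ^ 8 / r ^ 4 - 2 * lam ^ 4 = (r ^ 2 - lam ^ 4 / r ^ 2) ^ 2 := by
      field_simp
      ring
    rw [this]
    positivity
  have hg0 : ∀ r ∈ Ici lam,
      0 ≤ r ^ 4 * (1 - (lam / r) ^ 8) + a * r ^ 2 * (1 - (lam / r) ^ 4) := fun r hr => by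
    have hr0 : 0 < r := hlam.trans_le hr
    have h1 : lam / r ≤ 1 := (div_le_one hr0).2 hr
    have h8 : 0 ≤ 1 - (lam / r) ^ 8 := sub_nonneg.2 (pow_le_one₀ (by positivity) h1)
    have h4 : 0 ≤ 1 - (lam / r) ^ 4 := sub_nonneg.2 (pow_le_one₀ (by positivity) h1)
    positivity
  intro r hr
  have hr0 : 0 < r := hlam.trans_le hr
  refine le_trans ?_ (sub_nonneg.1 (nonneg_of_supersolution hn hlam
    (hf.1.sub (hφ.continuousOn.mono (Ici_subset_Ioi.2 hlam)))
    (hf.hasSecondDerivOn.sub (hφ.mono (Ioi_subset_Ioi hlam.le))) (fun x hx => ?_) ?_ ?_ r hr))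
  · beta_reduce
    rw [← mul_assoc, ← Ulam_eq_mul hlam hr0, hpoly r hr0, hg r hr0]
    have := mul_nonneg (Ulam_pos (n := n) hlam hr0).le (mul_nonneg hκ0 (hsq r hr0))
    linarith
  · have hx0 : 0 < x := hlam.trans hx
    have hBx : 0 ≤ (x ^ 2 + lam ^ 4) ^ (-(((n : ℝ) - 2) / 2)) := by positivity
    have key := subsolution_operator_nonneg (a := a) (κ := κ) (c := c)
      (p1 := 4 * (c + κ) * x ^ 3 + 2 * (c * a) * x - 2 * -(c * a * lam ^ 4) / x ^ 3
        - 4 * ((κ - c) * lam ^ 8) / x ^ 5)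
      (p2 := 12 * (c + κ) * x ^ 2 + 2 * (c * a) + 6 * -(c * a * lam ^ 4) / x ^ 4
        + 20 * ((κ - c) * lam ^ 8) / x ^ 6) hn' hlam (le_of_lt hx) hε hε1 hμ hBx ha hκ hc
      (hpoly x hx0) (by field_simp; ring) (by field_simp; ring)
    have hV := le_Vlam hn hlam (le_of_lt hx) hμ hη1
    have hsol := hf.2.2.1 x hx
    rw [Ulam_eq_mul hlam hx0] at hsol
    have hpx : 0 ≤ (c + κ) * x ^ 4 + c * a * x ^ 2 + -(2 * κ * lam ^ 4)
        + -(c * a * lam ^ 4) / x ^ 2 + (κ - c) * lam ^ 8 / x ^ 4 := by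
      rw [hpoly x hx0, hg x hx0]
      exact add_nonneg (mul_nonneg hc0 (hg0 x (Ioi_subset_Ici_self hx))) (mul_nonneg hκ0 (hsq x hx0))
    have hK : 0 ≤ lam ^ ((n : ℝ) - 2) := by positivity
    have h1 := mul_nonneg hK key
    have h2 := mul_nonneg hK (mul_nonneg (sub_nonneg.2 hV) (mul_nonneg hBx hpx))
    simp only [Pi.sub_apply]
    linarith
  · simp only [Pi.sub_apply]
    rw [hf.2.2.2.1, hpoly lam hlam]
    refine le_of_eq ?_
    field_simp
    ring
  · have h0 : Tendsto (fun x : ℝ => lam ^ ((n : ℝ) - 2) * (c * (1 + a) + 2 * κ) *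
        x ^ ((6 : ℝ) - n)) atTop (nhds 0) := tendsto_const_mul_rpow_six_sub hn _
    have hφ0 := tendsto_of_tendsto_of_tendsto_of_le_of_le' (g := fun _ : ℝ => (0 : ℝ))
      (f := fun r : ℝ => lam ^ ((n : ℝ) - 2) * ((r ^ 2 + lam ^ 4) ^ (-(((n : ℝ) - 2) / 2)) *
        ((c + κ) * r ^ 4 + c * a * r ^ 2 + -(2 * κ * lam ^ 4)
          + -(c * a * lam ^ 4) / r ^ 2 + (κ - c) * lam ^ 8 / r ^ 4))) tendsto_const_nhds h0
      (by
        filter_upwards [eventually_ge_atTop lam] with x hx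
        have hx0 : 0 < x := hlam.trans_le hx
        rw [hpoly x hx0, hg x hx0]
        have := add_nonneg (mul_nonneg hc0 (hg0 x hx)) (mul_nonneg hκ0 (hsq x hx0))
        positivity)
      (by
        filter_upwards [eventually_ge_atTop lam, eventually_ge_atTop 1] with x hx hx1
        have hx0 : 0 < x := hlam.trans_le hx
        have h1 : lam ^ 8 / x ^ 4 ≤ x ^ 4 := by
          rw [div_le_iff₀ (by positivity), ← pow_add]
          gcongr
        have h2 : x ^ 2 ≤ x ^ 4 := pow_le_pow_right₀ hx1 (by norm_num)
        have h3 : 0 ≤ lam ^ 8 / x ^ 4 := by positivity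
        have h4 : 0 ≤ lam ^ 4 / x ^ 2 := by positivity
        have h5 : 0 ≤ lam ^ 4 := by positivity
        have hpx : c * (x ^ 4 - lam ^ 8 / x ^ 4 + a * (x ^ 2 - lam ^ 4 / x ^ 2))
            + κ * (x ^ 4 + lam ^ 8 / x ^ 4 - 2 * lam ^ 4) ≤
            c * (x ^ 4 + a * x ^ 4) + κ * (2 * x ^ 4) := by
          gcongr <;> linarith
        have hU := Ulam_le hn hlam hx0
        rw [← mul_assoc, ← Ulam_eq_mul hlam hx0, hpoly x hx0]
        calc _ ≤ Ulam n lam x * (c * (x ^ 4 + a * x ^ 4) + κ * (2 * x ^ 4)) :=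
              mul_le_mul_of_nonneg_left hpx (Ulam_pos hlam hx0).le
          _ ≤ lam ^ ((n : ℝ) - 2) * (x ^ ((6 : ℝ) - n) / x ^ 4) *
                (c * (x ^ 4 + a * x ^ 4) + κ * (2 * x ^ 4)) := by gcongr
          _ = _ := by
              field_simp)
    have h := hf.2.2.2.2.sub hφ0
    rw [sub_zero] at h
    exact h

/-- for `n ≥ 10` and `λ > 0` there is a unique smooth solution
`f_{2,λ}` of the above boundary value problem on `(λ,∞)`.  Moreover there is a
constant `C = C(n)` and, for every `ε > 0`, a `δ(ε) > 0` with `δ(ε) → 0` as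
`ε → 0⁺`, such that whenever `|λ − 1| ≤ δ(ε)` the solution satisfies
`((1−ε)/(6(n−4))) U^λ(r) (r⁴(1−(λ/r)^8) + ((3n−4)/(n−2)) r²(1−(λ/r)^4))
  ≤ f_{2,λ}(r) ≤ C r^{6−n}` for all `r ∈ (λ,∞)`. -/
theorem statement4 (n : ℕ) (hn : 10 ≤ n) :
    (∀ lam : ℝ, 0 < lam →
      ∃ f : ℝ → ℝ, IsSolF2lam n lam f ∧
        ∀ g : ℝ → ℝ, IsSolF2lam n lam g → EqOn g f (Ici lam)) ∧
    ∃ C : ℝ, 0 < C ∧ ∃ δ : ℝ → ℝ, (∀ ε > (0 : ℝ), 0 < δ ε) ∧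
      Tendsto δ (nhdsWithin 0 (Ioi 0)) (nhds 0) ∧
      ∀ ε > (0 : ℝ), ∀ lam : ℝ, 0 < lam → |lam - 1| ≤ δ ε →
        ∀ f : ℝ → ℝ, IsSolF2lam n lam f → ∀ r ∈ Ioi lam,
          (1 - ε) / (6 * ((n : ℝ) - 4)) * Ulam n lam r *
              (r ^ 4 * (1 - (lam / r) ^ 8)
                + (3 * (n : ℝ) - 4) / ((n : ℝ) - 2) * r ^ 2 * (1 - (lam / r) ^ 4))
            ≤ f r ∧
          f r ≤ C * r ^ ((6 : ℝ) - (n : ℝ)) := by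
  have hn' : (10 : ℝ) ≤ n := by exact_mod_cast hn
  refine ⟨fun lam hlam => ?_, ?_⟩
  · obtain ⟨f, hf⟩ := exists_isSolF2lam hn hlam
    exact ⟨f, hf, fun g hg r hr => le_antisymm (hg.le hn hlam hf r hr) (hf.le hn hlam hg r hr)⟩
  obtain ⟨C, hC, hupper⟩ := exists_uniform_upper_bound hn
  have hn3 : (1000 : ℝ) ≤ (n : ℝ) ^ 3 := by linarith [pow_le_pow_left₀ (by norm_num) hn' 3]
  refine ⟨C, hC, fun ε => min ε 1 / (n : ℝ) ^ 3, fun ε hε => ?_, ?_,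
    fun ε hε lam hlam hδ f hf r hr => ?_⟩
  · have : 0 < min ε 1 := lt_min hε one_pos
    positivity
  · have h : Continuous fun ε : ℝ => min ε 1 / (n : ℝ) ^ 3 := by fun_prop
    simpa using (h.tendsto 0).mono_left nhdsWithin_le_nhds
  beta_reduce at hδ
  have hδ1 : min ε 1 / (n : ℝ) ^ 3 ≤ 1 / 2 := by
    rw [div_le_iff₀ (by positivity)]
    linarith [min_le_right ε 1]
  have hr' : r ∈ Ici lam := Ioi_subset_Ici_self hr
  refine ⟨?_, hupper lam (hδ.trans hδ1) f hf r hr'⟩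
  rcases le_total ε 1 with hε1 | hε1
  · refine hf.lower_bound hn hlam hε.le hε1 ?_ r hr'
    rw [min_eq_left hε1] at hδ hδ1
    have h1 : |lam + 1| ≤ 3 := by
      obtain ⟨h2, h3⟩ := abs_le.1 (hδ.trans hδ1)
      rw [abs_le]
      constructor <;> linarith
    rw [show lam ^ 2 - 1 = (lam - 1) * (lam + 1) by ring, abs_mul]
    calc _ ≤ ε / (n : ℝ) ^ 3 * 3 := mul_le_mul hδ h1 (abs_nonneg _) (by positivity)
      _ = _ := by ring
  · have hr0 : 0 < r := hlam.trans hr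
    have h1 : lam / r ≤ 1 := (div_le_one hr0).2 hr'
    have h8 : 0 ≤ 1 - (lam / r) ^ 8 := sub_nonneg.2 (pow_le_one₀ (by positivity) h1)
    have h4 : 0 ≤ 1 - (lam / r) ^ 4 := sub_nonneg.2 (pow_le_one₀ (by positivity) h1)
    have ha : 0 ≤ (3 * (n : ℝ) - 4) / ((n : ℝ) - 2) := div_nonneg (by linarith) (by linarith)
    refine le_trans (mul_nonpos_of_nonpos_of_nonneg (mul_nonpos_of_nonpos_of_nonneg
      (div_nonpos_of_nonpos_of_nonneg (by linarith) (by linarith)) (Ulam_pos hlam hr0).le)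
      (by positivity)) (hf.nonneg hn hlam r hr')
end

section
/- Let n ≥ 10 be an integer and set φ₂(r) = ((3n−4)/(6(n−4)(n−2)))·r²·U(r) for r > 0. Then for all r ∈ (0,∞), φ₂''(r) + ((n-1)/r)·φ₂'(r) + (n(n+2)·U(r)^{4/(n-2)} − 2n/r²)·φ₂(r) = −(2(3n−4)/(3(n−4)))·U(r)·( r²/(1+r²) − (n/(n−2))·r²·U(r)^{4/(n-2)} ). -/
open Set

/-- `φ₂(r) = ((3n−4)/(6(n−4)(n−2))) r² U(r)`. -/
noncomputable def phi2 (n : ℕ) (r : ℝ) : ℝ :=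
  (3 * (n : ℝ) - 4) / (6 * ((n : ℝ) - 4) * ((n : ℝ) - 2)) * r ^ 2 * U n r

lemma one_add_sq_pos (r : ℝ) : 0 < 1 + r ^ 2 := by positivity

lemma hasDerivAt_U (n : ℕ) (r : ℝ) :
    HasDerivAt (U n) (-((n : ℝ) - 2) * r / (1 + r ^ 2) * U n r) r := by
  have hs := one_add_sq_pos r
  have h : HasDerivAt (fun x : ℝ => 1 + x ^ 2) (2 * r) r := by
    simpa using (hasDerivAt_pow 2 r).const_add 1
  refine (h.rpow_const (p := -(((n : ℝ) - 2) / 2)) (Or.inl hs.ne')).congr_deriv ?_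
  rw [Real.rpow_sub_one hs.ne', U]
  field_simp

lemma U_rpow (n : ℕ) (hn : (n : ℝ) - 2 ≠ 0) (r : ℝ) :
    U n r ^ ((4 : ℝ) / ((n : ℝ) - 2)) = ((1 + r ^ 2) ^ 2)⁻¹ := by
  have hs := one_add_sq_pos r
  rw [U, ← Real.rpow_mul hs.le,
    show -(((n : ℝ) - 2) / 2) * (4 / ((n : ℝ) - 2)) = -(2 : ℕ) by
      push_cast; field_simp; norm_num,
    Real.rpow_neg hs.le, Real.rpow_natCast]

lemma hasDerivAt_phi2 (n : ℕ) (r : ℝ) :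
    HasDerivAt (phi2 n)
      ((3 * (n : ℝ) - 4) / (6 * ((n : ℝ) - 4) * ((n : ℝ) - 2)) *
        ((2 * r - ((n : ℝ) - 2) * r ^ 3 / (1 + r ^ 2)) * U n r)) r := by
  have h := ((hasDerivAt_pow 2 r).const_mul
    ((3 * (n : ℝ) - 4) / (6 * ((n : ℝ) - 4) * ((n : ℝ) - 2)))).mul (hasDerivAt_U n r)
  refine h.congr_deriv ?_
  push_cast
  ring

lemma hasDerivAt_deriv_phi2 (n : ℕ) (r : ℝ) :
    HasDerivAt (deriv (phi2 n))
      ((3 * (n : ℝ) - 4) / (6 * ((n : ℝ) - 4) * ((n : ℝ) - 2)) *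
        ((2 - ((n : ℝ) - 2) * (5 * r ^ 2 / (1 + r ^ 2) - n * r ^ 4 / (1 + r ^ 2) ^ 2)) *
          U n r)) r := by
  have hs := one_add_sq_pos r
  rw [funext fun x => (hasDerivAt_phi2 n x).deriv]
  have h : HasDerivAt (fun x : ℝ => 1 + x ^ 2) (2 * r) r := by
    simpa using (hasDerivAt_pow 2 r).const_add 1
  have hq := (((hasDerivAt_pow 3 r).const_mul ((n : ℝ) - 2)).div h hs.ne')
  have hp := (((hasDerivAt_id r).const_mul 2).sub hq).mul (hasDerivAt_U n r)
  refine (hp.const_mul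
    ((3 * (n : ℝ) - 4) / (6 * ((n : ℝ) - 4) * ((n : ℝ) - 2)))).congr_deriv ?_
  congr 1
  simp only [Pi.sub_apply, Pi.div_apply, id]
  push_cast
  field_simp
  ring

/-- for `n ≥ 10`, the function `φ₂(r) = ((3n−4)/(6(n−4)(n−2))) r² U(r)`
satisfies the explicit identity
`φ₂'' + ((n-1)/r)φ₂' + (n(n+2)U^{4/(n-2)} − 2n/r²)φ₂
  = −(2(3n−4)/(3(n−4))) U ( r²/(1+r²) − (n/(n−2)) r² U^{4/(n-2)} )` on `(0,∞)`. -/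
theorem statement7 (n : ℕ) (hn : 10 ≤ n) :
    ∀ r ∈ Ioi (0 : ℝ),
      deriv (deriv (phi2 n)) r + ((n : ℝ) - 1) / r * deriv (phi2 n) r +
          ((n : ℝ) * ((n : ℝ) + 2) * U n r ^ ((4 : ℝ) / ((n : ℝ) - 2))
            - 2 * (n : ℝ) / r ^ 2) * phi2 n r
        = -(2 * (3 * (n : ℝ) - 4) / (3 * ((n : ℝ) - 4))) * U n r *
            (r ^ 2 / (1 + r ^ 2)
              - ((n : ℝ) / ((n : ℝ) - 2)) * r ^ 2 * U n r ^ ((4 : ℝ) / ((n : ℝ) - 2))) := by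
  intro r hr
  have hr : r ≠ 0 := (mem_Ioi.mp hr).ne'
  have hs := one_add_sq_pos r
  have hn' : (10 : ℝ) ≤ n := by exact_mod_cast hn
  have h2 : (n : ℝ) - 2 ≠ 0 := by linarith
  have h4 : (n : ℝ) - 4 ≠ 0 := by linarith
  rw [(hasDerivAt_deriv_phi2 n r).deriv, (hasDerivAt_phi2 n r).deriv, U_rpow n h2, phi2]
  field_simp
  ring
end

section
/- Let k ≥ 1 and n ≥ 2 be integers, let j ∈ {1,…,n} be fixed, and let f be a smooth real-valued function defined on a neighborhood of 0 in ℝⁿ. Then ∫_{S^{n−1}} ( Σ_{p₁,…,p_{2k+1}=1}^{n} ∂_{p₁}⋯∂_{p_{2k+1}} f(0) · x^{p₁}⋯x^{p_{2k+1}} ) · x^{j} dσ(x) = C(n,k) · ∂_j(Δ^k f)(0), where C(n,k) = (2k+1)!·|S^{n−1}| / ( (2k+n)·2^k·k!·∏_{i=0}^{k−1}(n+2i) ) and Δ^k is the k-th iterate of the Euclidean Laplacian. -/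
open MeasureTheory

/-- The surface measure on the unit sphere `S^{n−1} ⊂ ℝⁿ`. -/
noncomputable def sphereMeasure (n : ℕ) :
    Measure (Metric.sphere (0 : EuclideanSpace ℝ (Fin n)) 1) :=
  (volume : Measure (EuclideanSpace ℝ (Fin n))).toSphere

/-- The partial derivative `∂ᵢ f` of a function on `ℝⁿ`. -/
noncomputable def pderiv (n : ℕ) (i : Fin n) (f : EuclideanSpace ℝ (Fin n) → ℝ) :
    EuclideanSpace ℝ (Fin n) → ℝ :=
  fun x => fderiv ℝ f x (EuclideanSpace.single i 1)

/-- The iterated partial derivative `∂_{p₁}⋯∂_{p_m} f` indexed by a tuple `p`. -/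
noncomputable def iteratedPDeriv (n : ℕ) :
    (m : ℕ) → (Fin m → Fin n) → (EuclideanSpace ℝ (Fin n) → ℝ) →
      EuclideanSpace ℝ (Fin n) → ℝ
  | 0, _, f => f
  | m + 1, p, f => pderiv n (p 0) (iteratedPDeriv n m (fun i => p i.succ) f)

/-- The Euclidean Laplacian `Δf = Σᵢ ∂ᵢ∂ᵢ f` on `ℝⁿ`. -/
noncomputable def lap (n : ℕ) (f : EuclideanSpace ℝ (Fin n) → ℝ) :
    EuclideanSpace ℝ (Fin n) → ℝ :=
  fun x => ∑ i : Fin n, pderiv n i (pderiv n i f) x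

section Derivatives

open scoped ContDiff

variable {n : ℕ} {f g : EuclideanSpace ℝ (Fin n) → ℝ} {x : EuclideanSpace ℝ (Fin n)}

lemma ContDiffAt.pderiv (hf : ContDiffAt ℝ ∞ f x) (i : Fin n) :
    ContDiffAt ℝ ∞ (pderiv n i f) x :=
  (hf.fderiv_right (m := ∞) (by simp)).clm_apply contDiffAt_const

lemma Filter.EventuallyEq.pderiv (h : f =ᶠ[nhds x] g) (i : Fin n) :
    pderiv n i f =ᶠ[nhds x] pderiv n i g :=
  (h.fderiv (𝕜 := ℝ)).mono fun y hy => by simp [_root_.pderiv, hy]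

lemma Filter.EventuallyEq.iteratedPDeriv (h : f =ᶠ[nhds x] g) :
    ∀ (m : ℕ) (p : Fin m → Fin n), iteratedPDeriv n m p f =ᶠ[nhds x] iteratedPDeriv n m p g
  | 0, _ => h
  | m + 1, p => (Filter.EventuallyEq.iteratedPDeriv h m _).pderiv (p 0)

lemma ContDiffAt.iteratedPDeriv (hf : ContDiffAt ℝ ∞ f x) :
    ∀ (m : ℕ) (p : Fin m → Fin n), ContDiffAt ℝ ∞ (iteratedPDeriv n m p f) x
  | 0, _ => hf
  | m + 1, p => (ContDiffAt.iteratedPDeriv hf m _).pderiv (p 0)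

lemma ContDiffAt.lap (hf : ContDiffAt ℝ ∞ f x) : ContDiffAt ℝ ∞ (lap n f) x :=
  ContDiffAt.sum fun i _ => (hf.pderiv i).pderiv i

lemma Filter.EventuallyEq.lap (h : f =ᶠ[nhds x] g) : lap n f =ᶠ[nhds x] lap n g := by
  have : ∀ᶠ y in nhds x, ∀ i,
      _root_.pderiv n i (_root_.pderiv n i f) y = _root_.pderiv n i (_root_.pderiv n i g) y :=
    Filter.eventually_all.2 fun i => (h.pderiv i).pderiv i
  exact this.mono fun y hy => Finset.sum_congr rfl fun i _ => hy i

lemma ContDiffAt.eventually_differentiableAt (hf : ContDiffAt ℝ ∞ f x) :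
    ∀ᶠ y in nhds x, DifferentiableAt ℝ f y :=
  ((hf.of_le (m := 1) (by simp)).eventually (by simp)).mono
    fun _ hy => hy.differentiableAt (by simp)

lemma pderiv_finset_sum {ι : Type*} {s : Finset ι} {F : ι → EuclideanSpace ℝ (Fin n) → ℝ}
    (hF : ∀ a ∈ s, ContDiffAt ℝ ∞ (F a) x) (i : Fin n) :
    pderiv n i (fun y => ∑ a ∈ s, F a y) =ᶠ[nhds x] fun y => ∑ a ∈ s, pderiv n i (F a) y := by
  have : ∀ᶠ y in nhds x, ∀ a ∈ s, DifferentiableAt ℝ (F a) y :=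
    (Filter.eventually_all_finset s).2 fun a ha => (hF a ha).eventually_differentiableAt
  refine this.mono fun y hy => ?_
  simp [pderiv, fderiv_fun_sum hy]

lemma iteratedPDeriv_finset_sum {ι : Type*} {s : Finset ι}
    {F : ι → EuclideanSpace ℝ (Fin n) → ℝ} (hF : ∀ a ∈ s, ContDiffAt ℝ ∞ (F a) x) :
    ∀ (m : ℕ) (p : Fin m → Fin n), iteratedPDeriv n m p (fun y => ∑ a ∈ s, F a y)
      =ᶠ[nhds x] fun y => ∑ a ∈ s, iteratedPDeriv n m p (F a) y
  | 0, _ => Filter.EventuallyEq.rfl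
  | m + 1, p => ((iteratedPDeriv_finset_sum hF m _).pderiv (p 0)).trans
      (pderiv_finset_sum (fun a ha => (hF a ha).iteratedPDeriv m _) (p 0))

lemma pderiv_comm (hf : ContDiffAt ℝ ∞ f x) (i j : Fin n) :
    pderiv n i (pderiv n j f) =ᶠ[nhds x] pderiv n j (pderiv n i f) := by
  have h2 : ∀ᶠ y in nhds x, ContDiffAt ℝ 2 f y :=
    (hf.of_le (m := 2) (WithTop.coe_le_coe.2 le_top)).eventually (by simp)
  refine h2.mono fun y hy => ?_
  have hd : DifferentiableAt ℝ (fderiv ℝ f) y :=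
    (hy.fderiv_right (m := 1) (by norm_num)).differentiableAt (by simp)
  have key : ∀ i j : Fin n, pderiv n i (pderiv n j f) y
      = fderiv ℝ (fderiv ℝ f) y (EuclideanSpace.single i 1) (EuclideanSpace.single j 1) := by
    intro i j
    unfold pderiv
    rw [fderiv_clm_apply hd (differentiableAt_const _)]
    simp
  rw [key, key]
  exact (hy.isSymmSndFDerivAt (by simp)).eq _ _

lemma pderiv_lap (hf : ContDiffAt ℝ ∞ f x) (j : Fin n) :
    pderiv n j (lap n f) =ᶠ[nhds x] lap n (pderiv n j f) := by
  refine (pderiv_finset_sum (fun i _ => (hf.pderiv i).pderiv i) j).trans ?_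
  have : ∀ᶠ y in nhds x, ∀ i, pderiv n j (pderiv n i (pderiv n i f)) y
      = pderiv n i (pderiv n i (pderiv n j f)) y :=
    Filter.eventually_all.2 fun i =>
      (pderiv_comm (hf.pderiv i) j i).trans ((pderiv_comm hf j i).pderiv i)
  exact this.mono fun y hy => Finset.sum_congr rfl fun i _ => hy i

lemma Filter.EventuallyEq.lap_iterate (h : f =ᶠ[nhds x] g) (k : ℕ) :
    (_root_.lap n)^[k] f =ᶠ[nhds x] (_root_.lap n)^[k] g := by
  induction k generalizing f g with
  | zero => exact h
  | succ k ih => exact ih h.lap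

lemma pderiv_lap_iterate (hf : ContDiffAt ℝ ∞ f x) (j : Fin n) (k : ℕ) :
    pderiv n j ((lap n)^[k] f) =ᶠ[nhds x] (lap n)^[k] (pderiv n j f) := by
  induction k generalizing f with
  | zero => rfl
  | succ k ih => exact (ih hf.lap).trans ((pderiv_lap hf j).lap_iterate k)

lemma iteratedPDeriv_succ_last (f : EuclideanSpace ℝ (Fin n) → ℝ) :
    ∀ (m : ℕ) (p : Fin (m + 1) → Fin n), iteratedPDeriv n (m + 1) p f
      = iteratedPDeriv n m (fun i => p i.castSucc) (pderiv n (p (Fin.last m)) f)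
  | 0, _ => rfl
  | m + 1, p => congrArg (pderiv n (p 0)) (iteratedPDeriv_succ_last f m fun i => p i.succ)

end Derivatives

section TaylorForm

open scoped ContDiff

/-- The form `x ↦ Σ_p ∂_{p₁}⋯∂_{p_m} f(0) x^{p₁}⋯x^{p_m}` of degree `m`. -/
noncomputable def taylorForm (n m : ℕ) (f : EuclideanSpace ℝ (Fin n) → ℝ)
    (x : EuclideanSpace ℝ (Fin n)) : ℝ :=
  ∑ p : Fin m → Fin n, iteratedPDeriv n m p f 0 * ∏ i, x (p i)

variable {n : ℕ} {f g : EuclideanSpace ℝ (Fin n) → ℝ}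

lemma taylorForm_zero (f : EuclideanSpace ℝ (Fin n) → ℝ) (x : EuclideanSpace ℝ (Fin n)) :
    taylorForm n 0 f x = f 0 := by
  simp [taylorForm, iteratedPDeriv]

lemma taylorForm_congr (h : f =ᶠ[nhds 0] g) (m : ℕ) : taylorForm n m f = taylorForm n m g := by
  ext x
  exact Finset.sum_congr rfl fun p _ => by rw [(h.iteratedPDeriv m p).eq_of_nhds]

lemma taylorForm_lap (hf : ContDiffAt ℝ ∞ f 0) (m : ℕ) (x : EuclideanSpace ℝ (Fin n)) :
    taylorForm n m (lap n f) x = ∑ i, taylorForm n m (pderiv n i (pderiv n i f)) x := by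
  simp only [taylorForm]
  rw [Finset.sum_comm]
  refine Finset.sum_congr rfl fun p _ => ?_
  rw [← Finset.sum_mul]
  congr 1
  exact (iteratedPDeriv_finset_sum (fun i _ => (hf.pderiv i).pderiv i) m p).eq_of_nhds

lemma taylorForm_succ (m : ℕ) (f : EuclideanSpace ℝ (Fin n) → ℝ)
    (x : EuclideanSpace ℝ (Fin n)) :
    taylorForm n (m + 1) f x = ∑ i, x i * taylorForm n m (pderiv n i f) x := by
  simp only [taylorForm]
  rw [← (Fin.snocEquiv fun _ : Fin (m + 1) => Fin n).sum_comp, Fintype.sum_prod_type]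
  refine Finset.sum_congr rfl fun i _ => ?_
  rw [Finset.mul_sum]
  refine Finset.sum_congr rfl fun p _ => ?_
  rw [iteratedPDeriv_succ_last, Fin.prod_univ_castSucc]
  simp [Fin.snocEquiv]
  ring

lemma taylorForm_smul (m : ℕ) (f : EuclideanSpace ℝ (Fin n) → ℝ) (r : ℝ)
    (x : EuclideanSpace ℝ (Fin n)) : taylorForm n m f (r • x) = r ^ m * taylorForm n m f x := by
  simp [taylorForm, Finset.prod_mul_distrib, Finset.mul_sum, mul_left_comm]

lemma differentiable_taylorForm (m : ℕ) (f : EuclideanSpace ℝ (Fin n) → ℝ) :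
    Differentiable ℝ (taylorForm n m f) := by
  unfold taylorForm
  fun_prop

lemma abs_taylorForm_le (m : ℕ) (f : EuclideanSpace ℝ (Fin n) → ℝ)
    (x : EuclideanSpace ℝ (Fin n)) :
    |taylorForm n m f x| ≤ (∑ p : Fin m → Fin n, |iteratedPDeriv n m p f 0|) * ‖x‖ ^ m := by
  rw [Finset.sum_mul]
  refine (Finset.abs_sum_le_sum_abs _ _).trans (Finset.sum_le_sum fun p _ => ?_)
  rw [abs_mul, Finset.abs_prod]
  gcongr
  calc ∏ i, |x (p i)| ≤ ∏ _i : Fin m, ‖x‖ :=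
        Finset.prod_le_prod (fun _ _ => abs_nonneg _) fun i _ => PiLp.norm_apply_le x (p i)
    _ = ‖x‖ ^ m := by simp

lemma pderiv_taylorForm (hf : ContDiffAt ℝ ∞ f 0) (m : ℕ) (j : Fin n)
    (x : EuclideanSpace ℝ (Fin n)) :
    pderiv n j (taylorForm n (m + 1) f) x = (m + 1) * taylorForm n m (pderiv n j f) x := by
  have step : ∀ m (f : EuclideanSpace ℝ (Fin n) → ℝ),
      pderiv n j (taylorForm n (m + 1) f) x = taylorForm n m (pderiv n j f) x
        + ∑ i, x i * pderiv n j (taylorForm n m (pderiv n i f)) x := by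
    intro m f
    have hc : ∀ i, HasFDerivAt (fun y : EuclideanSpace ℝ (Fin n) => y i)
        (EuclideanSpace.proj i : EuclideanSpace ℝ (Fin n) →L[ℝ] ℝ) x :=
      fun i => ContinuousLinearMap.hasFDerivAt
        (EuclideanSpace.proj i : EuclideanSpace ℝ (Fin n) →L[ℝ] ℝ)
    have h := HasFDerivAt.fun_sum (u := Finset.univ) fun i _ => (hc i).fun_mul
      ((differentiable_taylorForm m (pderiv n i f)) x).hasFDerivAt
    rw [show taylorForm n (m + 1) f = _ from funext (taylorForm_succ m f)]
    simp only [pderiv] at h ⊢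
    rw [h.fderiv]
    simp [Finset.sum_add_distrib, add_comm]
  induction m generalizing f with
  | zero =>
    rw [step]
    have : ∀ g : EuclideanSpace ℝ (Fin n) → ℝ, pderiv n j (taylorForm n 0 g) x = 0 := by
      intro g
      simp [pderiv, show taylorForm n 0 g = _ from funext (taylorForm_zero g)]
    simp [this]
  | succ m ih =>
    rw [step]
    have : ∀ i, pderiv n j (taylorForm n (m + 1) (pderiv n i f)) x
        = (m + 1) * taylorForm n m (pderiv n i (pderiv n j f)) x := fun i => by
      rw [ih (hf.pderiv i), taylorForm_congr (pderiv_comm hf j i)]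
    simp only [this, mul_left_comm _ ((m : ℝ) + 1), ← Finset.mul_sum, ← taylorForm_succ]
    push_cast
    ring

end TaylorForm

section Gaussian

open Set

/-- The radial Gaussian moment `∫₀^∞ r^q exp(-r²/2) dr`. -/
noncomputable def gaussianRadialMoment (q : ℕ) : ℝ :=
  ∫ r in Ioi (0 : ℝ), r ^ q * Real.exp (-(1 / 2) * r ^ 2)

lemma gaussianRadialMoment_eq (q : ℕ) :
    gaussianRadialMoment q
      = (1 / 2 : ℝ) ^ (-((q : ℝ) + 1) / 2) * (1 / 2) * Real.Gamma (((q : ℝ) + 1) / 2) := by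
  rw [← integral_rpow_mul_exp_neg_mul_rpow (p := 2) (q := q) (by norm_num)
    (by linarith [q.cast_nonneg (α := ℝ)]) (by norm_num)]
  exact setIntegral_congr_fun measurableSet_Ioi fun r _ => by norm_cast

lemma gaussianRadialMoment_pos (q : ℕ) : 0 < gaussianRadialMoment q := by
  rw [gaussianRadialMoment_eq]
  have := Real.Gamma_pos_of_pos (s := ((q : ℝ) + 1) / 2) (by positivity)
  positivity

lemma gaussianRadialMoment_add_two (q : ℕ) :
    gaussianRadialMoment (q + 2) = (q + 1) * gaussianRadialMoment q := by
  rw [gaussianRadialMoment_eq, gaussianRadialMoment_eq]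
  have h1 : ((q + 2 : ℕ) + 1 : ℝ) / 2 = ((q : ℝ) + 1) / 2 + 1 := by push_cast; ring
  have h2 : -((q + 2 : ℕ) + 1 : ℝ) / 2 = -((q : ℝ) + 1) / 2 - 1 := by push_cast; ring
  rw [h1, h2, Real.Gamma_add_one (by positivity), Real.rpow_sub_one (by norm_num)]
  ring

lemma gaussianRadialMoment_add_two_mul (q k : ℕ) :
    gaussianRadialMoment (q + 2 * k)
      = (∏ i ∈ Finset.range k, ((q : ℝ) + 1 + 2 * i)) * gaussianRadialMoment q := by
  induction k with
  | zero => simp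
  | succ k ih =>
    rw [show q + 2 * (k + 1) = q + 2 * k + 2 by ring, gaussianRadialMoment_add_two, ih,
      Finset.prod_range_succ]
    push_cast
    ring

/-- The Gaussian weight `exp(-‖x‖²/2)`. -/
noncomputable def gaussianWeight {n : ℕ} (x : EuclideanSpace ℝ (Fin n)) : ℝ :=
  Real.exp (-(1 / 2) * ‖x‖ ^ 2)

variable {n : ℕ}

lemma hasFDerivAt_gaussianWeight (x : EuclideanSpace ℝ (Fin n)) :
    HasFDerivAt gaussianWeight (-gaussianWeight x • innerSL ℝ x) x := by
  refine ((hasStrictFDerivAt_norm_sq x).hasFDerivAt.const_mul (-(1 / 2))).exp.congr_fderiv ?_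
  ext v
  simp [gaussianWeight]

lemma pderiv_gaussianWeight (j : Fin n) (x : EuclideanSpace ℝ (Fin n)) :
    pderiv n j gaussianWeight x = -(x j * gaussianWeight x) := by
  simp [pderiv, (hasFDerivAt_gaussianWeight x).fderiv, EuclideanSpace.inner_single_right, mul_comm]

lemma integrable_mul_gaussianWeight [NeZero n] {Q : EuclideanSpace ℝ (Fin n) → ℝ}
    (hQ : Continuous Q) {C : ℝ} {d : ℕ} (hC : ∀ x, |Q x| ≤ C * ‖x‖ ^ d) :
    Integrable fun x => Q x * gaussianWeight x := by
  have h : Integrable fun x : EuclideanSpace ℝ (Fin n) => ‖x‖ ^ d * gaussianWeight x := by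
    refine (integrable_fun_norm_addHaar volume
      (f := fun r : ℝ => r ^ d * Real.exp (-(1 / 2) * r ^ 2))).2 ?_
    refine (integrableOn_rpow_mul_exp_neg_mul_sq (b := 1 / 2) (s := ((n - 1 + d : ℕ) : ℝ))
      (by norm_num) (neg_one_lt_zero.trans_le (Nat.cast_nonneg _))).congr_fun ?_ measurableSet_Ioi
    intro r _
    simp only [Real.rpow_natCast, pow_add, mul_assoc, finrank_euclideanSpace_fin, smul_eq_mul]
  have hw : Continuous (gaussianWeight (n := n)) := by unfold gaussianWeight; fun_prop
  refine (h.const_mul C).mono' (hQ.mul hw).aestronglyMeasurable (.of_forall fun x => ?_)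
  have hpos : 0 ≤ gaussianWeight x := (Real.exp_pos _).le
  rw [Real.norm_eq_abs, abs_mul, abs_of_nonneg hpos, ← mul_assoc]
  gcongr
  exact hC x

lemma integral_homogeneous_mul_gaussianWeight [NeZero n] {Q : EuclideanSpace ℝ (Fin n) → ℝ}
    {d : ℕ} (hQ : ∀ (r : ℝ) x, Q (r • x) = r ^ d * Q x) :
    ∫ x, Q x * gaussianWeight x
      = (∫ x, Q x ∂(sphereMeasure n)) * gaussianRadialMoment (n - 1 + d) := by
  set μ : Measure (EuclideanSpace ℝ (Fin n)) := volume
  let G : Ioi (0 : ℝ) → ℝ := fun r => (r : ℝ) ^ d * Real.exp (-(1 / 2) * (r : ℝ) ^ 2)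
  calc ∫ x, Q x * gaussianWeight x
      = ∫ x : ({0}ᶜ : Set (EuclideanSpace ℝ (Fin n))), Q x * gaussianWeight x.1
          ∂(μ.comap (↑)) := by
        rw [integral_subtype_comap (measurableSet_singleton _).compl
          fun x => Q x * gaussianWeight x, restrict_compl_singleton]
    _ = ∫ z, Q z.1 * G z.2 ∂(μ.toSphere.prod (.volumeIoiPow (n - 1))) := by
        have := μ.measurePreserving_homeomorphUnitSphereProd.integral_comp
          (Homeomorph.measurableEmbedding _) fun z => Q z.1 * G z.2
        rw [finrank_euclideanSpace_fin] at this
        rw [← this]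
        congr 1
        ext x
        have hx : ‖(x : EuclideanSpace ℝ (Fin n))‖ ≠ 0 := norm_ne_zero_iff.2 x.2
        have hQx := hQ ‖(x : EuclideanSpace ℝ (Fin n))‖
          (‖(x : EuclideanSpace ℝ (Fin n))‖⁻¹ • (x : EuclideanSpace ℝ (Fin n)))
        rw [smul_inv_smul₀ hx] at hQx
        simp only [G, homeomorphUnitSphereProd_apply_fst_coe,
          homeomorphUnitSphereProd_apply_snd_coe, gaussianWeight]
        rw [hQx]
        ring
    _ = (∫ x, Q x ∂(sphereMeasure n)) * ∫ r, G r ∂(.volumeIoiPow (n - 1)) :=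
        integral_prod_mul (fun x : Metric.sphere (0 : EuclideanSpace ℝ (Fin n)) 1 => Q x) G
    _ = _ := by
        congr 1
        simp only [Measure.volumeIoiPow, ENNReal.ofReal]
        rw [integral_withDensity_eq_integral_smul
            (measurable_subtype_coe.pow_const _).real_toNNReal,
          integral_subtype_comap measurableSet_Ioi fun r : ℝ =>
            Real.toNNReal (r ^ (n - 1)) • (r ^ d * Real.exp (-(1 / 2) * r ^ 2))]
        refine setIntegral_congr_fun measurableSet_Ioi fun r hr => ?_
        rw [NNReal.smul_def, Real.coe_toNNReal _ (pow_nonneg hr.out.le _), smul_eq_mul, pow_add,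
          mul_assoc]

open scoped ContDiff

variable {f : EuclideanSpace ℝ (Fin n) → ℝ}

lemma integrable_taylorForm_mul_gaussianWeight [NeZero n] (m : ℕ)
    (f : EuclideanSpace ℝ (Fin n) → ℝ) :
    Integrable fun x => taylorForm n m f x * gaussianWeight x :=
  integrable_mul_gaussianWeight (differentiable_taylorForm m f).continuous (abs_taylorForm_le m f)

lemma integrable_taylorForm_mul_coord_mul_gaussianWeight [NeZero n] (m : ℕ)
    (f : EuclideanSpace ℝ (Fin n) → ℝ) (j : Fin n) :
    Integrable fun x => taylorForm n m f x * x j * gaussianWeight x := by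
  have hc := (differentiable_taylorForm m f).continuous
  refine integrable_mul_gaussianWeight (by fun_prop)
    (C := ∑ p : Fin m → Fin n, |iteratedPDeriv n m p f 0|) (d := m + 1) fun x => ?_
  rw [abs_mul, pow_succ, ← mul_assoc]
  exact mul_le_mul (abs_taylorForm_le m f x) (PiLp.norm_apply_le x j) (abs_nonneg _)
    ((abs_nonneg _).trans (abs_taylorForm_le m f x))

lemma integral_taylorForm_mul_coord_mul_gaussianWeight [NeZero n] (hf : ContDiffAt ℝ ∞ f 0)
    (m : ℕ) (j : Fin n) :
    ∫ x, taylorForm n (m + 1) f x * x j * gaussianWeight x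
      = (m + 1) * ∫ x, taylorForm n m (pderiv n j f) x * gaussianWeight x := by
  have hd := pderiv_taylorForm hf m j
  have hg := pderiv_gaussianWeight j
  have hi := integrable_taylorForm_mul_coord_mul_gaussianWeight (m + 1) f j
  simp only [pderiv] at hd hg
  have h := integral_mul_fderiv_eq_neg_fderiv_mul_of_integrable (μ := volume)
    (f := taylorForm n (m + 1) f) (g := gaussianWeight) (v := EuclideanSpace.single j 1)
    (by
      simp only [hd, mul_assoc]
      exact (integrable_taylorForm_mul_gaussianWeight m (pderiv n j f)).const_mul _)
    (by simpa only [hg, mul_neg, mul_assoc] using hi.fun_neg)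
    (integrable_taylorForm_mul_gaussianWeight _ f)
    (fun x _ => differentiable_taylorForm _ f x)
    (fun x _ => (hasFDerivAt_gaussianWeight x).differentiableAt)
  simp only [hd, hg, mul_neg, integral_neg, neg_inj, mul_assoc, integral_const_mul] at h
  simpa only [mul_assoc] using h

lemma integral_taylorForm_add_two_mul_gaussianWeight [NeZero n] (hf : ContDiffAt ℝ ∞ f 0)
    (m : ℕ) :
    ∫ x, taylorForm n (m + 2) f x * gaussianWeight x
      = (m + 1) * ∫ x, taylorForm n m (lap n f) x * gaussianWeight x := by
  simp only [taylorForm_succ (m + 1) f, taylorForm_lap hf, Finset.sum_mul]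
  rw [integral_finsetSum _ fun i _ =>
      integrable_taylorForm_mul_gaussianWeight m (pderiv n i (pderiv n i f)), Finset.mul_sum,
    integral_finsetSum]
  · refine Finset.sum_congr rfl fun i _ => ?_
    rw [← integral_taylorForm_mul_coord_mul_gaussianWeight (hf.pderiv i) m i]
    simp only [mul_comm]
  · intro i _
    simpa only [mul_comm] using
      integrable_taylorForm_mul_coord_mul_gaussianWeight (m + 1) (pderiv n i f) i

lemma integral_taylorForm_two_mul_mul_gaussianWeight [NeZero n] (hf : ContDiffAt ℝ ∞ f 0)
    (k : ℕ) :
    ∫ x, taylorForm n (2 * k) f x * gaussianWeight x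
      = (∏ i ∈ Finset.range k, (2 * (i : ℝ) + 1)) * (lap n)^[k] f 0
        * ∫ x : EuclideanSpace ℝ (Fin n), gaussianWeight x := by
  induction k generalizing f with
  | zero => simp [taylorForm_zero, integral_const_mul]
  | succ k ih =>
    rw [show 2 * (k + 1) = 2 * k + 2 by ring, integral_taylorForm_add_two_mul_gaussianWeight hf,
      ih hf.lap, Finset.prod_range_succ, Function.iterate_succ_apply]
    push_cast
    ring

end Gaussian

lemma factorial_two_mul_add_one_eq (k : ℕ) :
    ((2 * k + 1).factorial : ℝ)
      = (2 * k + 1) * (∏ i ∈ Finset.range k, (2 * (i : ℝ) + 1)) * (2 ^ k * k.factorial) := by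
  induction k with
  | zero => simp
  | succ k ih =>
    rw [show 2 * (k + 1) + 1 = 2 * k + 1 + 1 + 1 by ring, Nat.factorial_succ (2 * k + 1 + 1),
      Nat.factorial_succ (2 * k + 1), Finset.prod_range_succ, Nat.factorial_succ k]
    push_cast
    rw [ih]
    ring

/-- for `f` smooth near `0` in `ℝⁿ`, `k ≥ 1` and `j ∈ {1,…,n}`,
`∫_{S^{n−1}} (Σ_{p₁,…,p_{2k+1}} ∂_{p₁}⋯∂_{p_{2k+1}}f(0) x^{p₁}⋯x^{p_{2k+1}}) x^j dσ(x)
  = C(n,k) ∂ⱼ(Δᵏf)(0)` with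
`C(n,k) = (2k+1)!|S^{n−1}| / ((2k+n) 2ᵏ k! ∏_{i=0}^{k−1}(n+2i))`. -/
theorem statement9 (n k : ℕ) (hn : 2 ≤ n) (hk : 1 ≤ k) (j : Fin n)
    (f : EuclideanSpace ℝ (Fin n) → ℝ)
    (s : Set (EuclideanSpace ℝ (Fin n))) (hs : s ∈ nhds (0 : EuclideanSpace ℝ (Fin n)))
    (hf : ContDiffOn ℝ (⊤ : ℕ∞) f s) :
    ∫ x : Metric.sphere (0 : EuclideanSpace ℝ (Fin n)) 1,
        (∑ p : Fin (2 * k + 1) → Fin n,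
          iteratedPDeriv n (2 * k + 1) p f 0 *
            ∏ i : Fin (2 * k + 1), (x : EuclideanSpace ℝ (Fin n)) (p i)) *
          (x : EuclideanSpace ℝ (Fin n)) j
        ∂(sphereMeasure n)
      = ((2 * k + 1).factorial * (sphereMeasure n Set.univ).toReal /
            (((2 * k + n : ℕ) : ℝ) * 2 ^ k * (k.factorial : ℝ) *
              ∏ i ∈ Finset.range k, ((n : ℝ) + 2 * (i : ℝ)))) *
          pderiv n j ((lap n)^[k] f) 0 := by
  have : NeZero n := ⟨by omega⟩
  have hf0 : ContDiffAt ℝ (⊤ : ℕ∞) f 0 := hf.contDiffAt hs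
  change ∫ x : Metric.sphere (0 : EuclideanSpace ℝ (Fin n)) 1,
    taylorForm n (2 * k + 1) f x * (x : EuclideanSpace ℝ (Fin n)) j ∂(sphereMeasure n) = _
  have hgauss := integral_taylorForm_mul_coord_mul_gaussianWeight hf0 (2 * k) j
  rw [integral_taylorForm_two_mul_mul_gaussianWeight (hf0.pderiv j),
    ← (pderiv_lap_iterate hf0 j k).eq_of_nhds,
    integral_homogeneous_mul_gaussianWeight (d := 2 * (k + 1)) fun r x => by
      rw [taylorForm_smul, PiLp.smul_apply, smul_eq_mul]; ring,
    gaussianRadialMoment_add_two_mul, Finset.prod_range_succ] at hgauss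
  have hone := integral_homogeneous_mul_gaussianWeight (n := n) (d := 0) (Q := fun _ => 1)
    (by simp)
  simp only [one_mul, integral_const, smul_eq_mul, mul_one, add_zero] at hone
  have hn1 : ((n - 1 : ℕ) : ℝ) + 1 = n := by
    rw [Nat.cast_sub (by omega)]; simp
  rw [hone, hn1] at hgauss
  have hr := (gaussianRadialMoment_pos (n - 1)).ne'
  have hprod : (∏ i ∈ Finset.range k, ((n : ℝ) + 2 * (i : ℝ))) ≠ 0 :=
    (Finset.prod_pos fun i _ => by positivity).ne'
  have hnk : (2 * (k : ℝ) + n) ≠ 0 := by positivity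
  rw [factorial_two_mul_add_one_eq, ← measureReal_def]
  push_cast at hgauss ⊢
  have hfact : (k.factorial : ℝ) ≠ 0 := by positivity
  field_simp
  refine mul_right_cancel₀ hr ?_
  linear_combination hgauss
end
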